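/- arXiv:1705.10404 — 5 statements merged into one kernel-verified Lean document; each statement's English description precedes it below -/
import Mathlib

section
/- Let p ≥ 3 be an odd integer and let T̂ = T + E ∈ ⊗^p ℝ^n, where T = Σ_{i=1}^n λ_i v_i^⊗p is SOD with λ_i > 0 for all i, {v₁,…,v_n} an orthonormal basis of ℝ^n, and E is a symmetric tensor with operator norm ε := ‖E‖. Let x̂ be a maximizer of T̂ x^⊗p over unit vectors x, let λ̂ := T̂ x̂^⊗p, set x_i := ⟨v_i, x̂⟩, and let j ∈ {1,…,n} be an index maximizing λ_i |x_i|^{p−2}. Then: λ_j ≥ (max_{i} λ_i) − 2ε; |x_j| ≥ 1 − 2ε/λ_j; x_j² ≥ x_j^{p−1} ≥ 1 − 4ε/λ_j; and |λ̂ − λ_j| ≤ ε. -/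
open scoped RealInnerProductSpace BigOperators

/-- The symmetric rank-one tensor `v^⊗p`, with entries `v_{i₁} ⋯ v_{i_p}`. -/
noncomputable def tpow {n : ℕ} (p : ℕ) (v : EuclideanSpace ℝ (Fin n)) : (Fin p → Fin n) → ℝ :=
  fun idx => ∏ k, v (idx k)

/-- `T x^⊗p = ∑_{i₁,…,i_p} T_{i₁,…,i_p} x_{i₁} ⋯ x_{i_p}`. -/
noncomputable def tapply {p n : ℕ} (T : (Fin p → Fin n) → ℝ) (x : EuclideanSpace ℝ (Fin n)) : ℝ :=
  ∑ idx : Fin p → Fin n, T idx * ∏ k, x (idx k)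

/-- A tensor is symmetric if its entries are invariant under all permutations of the indices. -/
def tsymm {p n : ℕ} (T : (Fin p → Fin n) → ℝ) : Prop :=
  ∀ (σ : Equiv.Perm (Fin p)) (idx : Fin p → Fin n), T (idx ∘ σ) = T idx

/-- Operator norm of a (symmetric) tensor: `sup_{‖x‖₂=1} |T x^⊗p|`. -/
noncomputable def tnorm {p n : ℕ} (T : (Fin p → Fin n) → ℝ) : ℝ :=
  sSup {r | ∃ x : EuclideanSpace ℝ (Fin n), ‖x‖ = 1 ∧ |tapply T x| = r}

theorem tapply_tpow {p n : ℕ} (v x : EuclideanSpace ℝ (Fin n)) :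
    tapply (tpow p v) x = ⟪v, x⟫ ^ p := by
  simp only [tapply, tpow, ← Finset.prod_mul_distrib]
  rw [← Fintype.sum_pow (fun a => v a * x a) p, PiLp.inner_apply]
  simp [mul_comm]

theorem tapply_add {p n : ℕ} (S T : (Fin p → Fin n) → ℝ) (x : EuclideanSpace ℝ (Fin n)) :
    tapply (S + T) x = tapply S x + tapply T x := by
  simp [tapply, add_mul, Finset.sum_add_distrib]

theorem tapply_sum_smul {p n : ℕ} {ι : Type*} (s : Finset ι) (c : ι → ℝ)
    (T : ι → (Fin p → Fin n) → ℝ) (x : EuclideanSpace ℝ (Fin n)) :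
    tapply (∑ i ∈ s, c i • T i) x = ∑ i ∈ s, c i * tapply (T i) x := by
  simp only [tapply, Finset.sum_apply, Pi.smul_apply, smul_eq_mul, Finset.sum_mul, Finset.mul_sum]
  rw [Finset.sum_comm]
  simp only [mul_assoc]

theorem abs_tapply_le_tnorm {p n : ℕ} (T : (Fin p → Fin n) → ℝ)
    {x : EuclideanSpace ℝ (Fin n)} (hx : ‖x‖ = 1) : |tapply T x| ≤ tnorm T := by
  refine le_csSup ⟨∑ idx, |T idx|, ?_⟩ ⟨x, hx, rfl⟩
  rintro _ ⟨y, hy, rfl⟩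
  refine (Finset.abs_sum_le_sum_abs _ _).trans (Finset.sum_le_sum fun idx _ => ?_)
  rw [abs_mul, Finset.abs_prod]
  refine mul_le_of_le_one_right (abs_nonneg _) (Finset.prod_le_one (fun _ _ => abs_nonneg _) ?_)
  intro k _
  simpa [hy] using PiLp.norm_apply_le y (idx k)

/-- A weighted sum of `p`-th powers of coordinates in an orthonormal family is controlled by any
common bound on the weights times the `(p - 2)`-th powers. -/
theorem sum_mul_inner_pow_le {n p : ℕ} (hp : 2 ≤ p) {lam : Fin n → ℝ} (hlam : ∀ i, 0 < lam i)
    {v : Fin n → EuclideanSpace ℝ (Fin n)} (hv : Orthonormal ℝ v)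
    {x : EuclideanSpace ℝ (Fin n)} (hx : ‖x‖ = 1) {M : ℝ} (hM0 : 0 ≤ M)
    (hM : ∀ i, lam i * |⟪v i, x⟫| ^ (p - 2) ≤ M) :
    ∑ i, lam i * ⟪v i, x⟫ ^ p ≤ M := by
  have bessel : ∑ i, ⟪v i, x⟫ ^ 2 ≤ 1 := by
    simpa [hx] using hv.sum_inner_products_le x (s := Finset.univ)
  calc ∑ i, lam i * ⟪v i, x⟫ ^ p
      ≤ ∑ i, M * ⟪v i, x⟫ ^ 2 := Finset.sum_le_sum fun i _ => by
        calc lam i * ⟪v i, x⟫ ^ p ≤ lam i * |⟪v i, x⟫| ^ p := by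
              refine mul_le_mul_of_nonneg_left ?_ (hlam i).le
              rw [← abs_pow]
              exact le_abs_self _
          _ = lam i * |⟪v i, x⟫| ^ (p - 2) * ⟪v i, x⟫ ^ 2 := by
              rw [← sq_abs ⟪v i, x⟫, mul_assoc, ← pow_add, Nat.sub_add_cancel hp]
          _ ≤ M * ⟪v i, x⟫ ^ 2 := mul_le_mul_of_nonneg_right (hM i) (sq_nonneg _)
    _ = M * ∑ i, ⟪v i, x⟫ ^ 2 := (Finset.mul_sum _ _ _).symm
    _ ≤ M := mul_le_of_le_one_right hM0 bessel

/-- Lemma 2.2 of the paper. Let `p ≥ 3` be odd, `T̂ = ∑ λᵢ vᵢ^⊗p + E`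
with `{vᵢ}` orthonormal, `λᵢ > 0`, `E` symmetric of operator norm `ε`. Let `x̂` maximize
`T̂ x^⊗p` over unit vectors, `λ̂ := T̂ x̂^⊗p`, `xᵢ := ⟨vᵢ, x̂⟩`, and let `j` maximize
`λᵢ |xᵢ|^{p−2}`. Then `λⱼ ≥ λ_max − 2ε`, `|xⱼ| ≥ 1 − 2ε/λⱼ`,
`xⱼ² ≥ xⱼ^{p−1} ≥ 1 − 4ε/λⱼ`, and `|λ̂ − λⱼ| ≤ ε`. -/
theorem sroa_first_step_lemma
    {n : ℕ} (p : ℕ) (hodd : Odd p) (hp : 3 ≤ p)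
    (lam : Fin n → ℝ) (hlam : ∀ i, 0 < lam i)
    (v : Fin n → EuclideanSpace ℝ (Fin n)) (hv : Orthonormal ℝ v)
    (E : (Fin p → Fin n) → ℝ) (hE : tsymm E)
    (ε : ℝ) (hε : ε = tnorm E)
    (Th : (Fin p → Fin n) → ℝ) (hTh : Th = (∑ i, lam i • tpow p (v i)) + E)
    (xh : EuclideanSpace ℝ (Fin n)) (hxh : ‖xh‖ = 1)
    (hmax : ∀ y : EuclideanSpace ℝ (Fin n), ‖y‖ = 1 → tapply Th y ≤ tapply Th xh)
    (j : Fin n)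
    (hj : ∀ i, lam i * |⟪v i, xh⟫| ^ (p - 2) ≤ lam j * |⟪v j, xh⟫| ^ (p - 2)) :
    Finset.univ.sup' ⟨j, Finset.mem_univ j⟩ lam - 2 * ε ≤ lam j ∧
    1 - 2 * ε / lam j ≤ |⟪v j, xh⟫| ∧
    (1 - 4 * ε / lam j ≤ ⟪v j, xh⟫ ^ (p - 1) ∧ ⟪v j, xh⟫ ^ (p - 1) ≤ ⟪v j, xh⟫ ^ 2) ∧
    |tapply Th xh - lam j| ≤ ε := by
  have hT : ∀ y, tapply Th y = ∑ i, lam i * ⟪v i, y⟫ ^ p + tapply E y := fun y => by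
    simp only [hTh, tapply_add, tapply_sum_smul, tapply_tpow]
  have hEb : ∀ y : EuclideanSpace ℝ (Fin n), ‖y‖ = 1 → |tapply E y| ≤ ε := fun y hy =>
    hε ▸ abs_tapply_le_tnorm E hy
  have hlow : ∀ i, lam i - ε ≤ tapply Th xh := fun i => by
    have h := hmax (v i) (hv.1 i)
    have hsum : ∑ k, lam k * ⟪v k, v i⟫ ^ p = lam i := by
      simp [orthonormal_iff_ite.mp hv, ite_pow, show p ≠ 0 by lia]
    rw [hT (v i), hsum] at h
    linarith [(abs_le.mp (hEb _ (hv.1 i))).1]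
  have hlj := hlam j
  have hup : tapply Th xh ≤ lam j * |⟪v j, xh⟫| ^ (p - 2) + ε := by
    rw [hT]
    exact add_le_add (sum_mul_inner_pow_le (by lia) hlam hv hxh (by positivity) hj)
      (abs_le.mp (hEb _ hxh)).2
  have ht1 : |⟪v j, xh⟫| ≤ 1 := by
    simpa [hv.1 j, hxh] using abs_real_inner_le_norm (v j) xh
  have hxp : |⟪v j, xh⟫| ^ (p - 1) = ⟪v j, xh⟫ ^ (p - 1) :=
    (Nat.Odd.sub_odd hodd odd_one).pow_abs _
  rw [← hxp, ← sq_abs ⟪v j, xh⟫]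
  set t := |⟪v j, xh⟫|
  have ht0 : 0 ≤ t := abs_nonneg _
  have hpow1 : t ^ (p - 2) ≤ 1 := pow_le_one₀ ht0 ht1
  have hpowt : t ^ (p - 2) ≤ t := pow_le_of_le_one ht0 ht1 (by lia)
  have hmul1 : lam j * t ^ (p - 2) ≤ lam j := mul_le_of_le_one_right hlj.le hpow1
  have hkey : 1 - 2 * ε / lam j ≤ t ^ (p - 2) := by
    rw [one_sub_div hlj.ne', div_le_iff₀ hlj]
    linarith [hlow j]
  refine ⟨?_, hkey.trans hpowt, ⟨?_, pow_le_pow_of_le_one ht0 ht1 (by lia)⟩, ?_⟩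
  · rw [sub_le_iff_le_add]
    exact Finset.sup'_le _ _ fun i _ => by linarith [hlow i]
  · have hsplit : t ^ (p - 1) = t ^ (p - 2) * t := by
      rw [← pow_succ]
      congr 1
      lia
    rw [hsplit, show 4 * ε / lam j = 2 * (2 * ε / lam j) by ring]
    nlinarith [mul_nonneg (sub_nonneg.mpr hpow1) (sub_nonneg.mpr ht1)]
  · rw [abs_le]
    constructor <;> linarith [hlow j]
end

section
/- Let p ≥ 3 be an odd integer and let T = Σ_{i=1}^n λ_i v_i^⊗p ∈ ⊗^p ℝ^n be SOD with λ_i > 0 for all i and {v₁,…,v_n} an orthonormal basis of ℝ^n. Apply SROA to T̂ := T (no perturbation), producing pairs (λ̂_i, v̂_i) for i = 1,…,n. Then there exists a permutation π of {1,…,n} such that λ̂_i = λ_{π(i)} and v̂_i = v_{π(i)} for all i; i.e., SROA recovers the decomposition {(λ_i, v_i)}_{i=1}^n exactly. -/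
open scoped RealInnerProductSpace BigOperators

theorem tapply_sum_smul_tpow {ι : Type*} {p n : ℕ} (S : Finset ι) (lam : ι → ℝ)
    (v : ι → EuclideanSpace ℝ (Fin n)) (x : EuclideanSpace ℝ (Fin n)) :
    tapply (∑ i ∈ S, lam i • tpow p (v i)) x = ∑ i ∈ S, lam i * ⟪v i, x⟫ ^ p := by
  simp only [← tapply_tpow]
  simp only [tapply, Finset.sum_apply, Pi.smul_apply, smul_eq_mul, Finset.sum_mul,
    Finset.mul_sum]
  rw [Finset.sum_comm]
  simp only [mul_assoc]

/-- A maximizer over the unit sphere of an orthogonally decomposed tensor of odd order with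
positive weights is one of the components. -/
theorem exists_eq_of_isMax_sum_inner_pow {ι E : Type*} [NormedAddCommGroup E]
    [InnerProductSpace ℝ E] {p : ℕ} (hodd : Odd p) (hp : 3 ≤ p) {S : Finset ι}
    (hS : S.Nonempty) {lam : ι → ℝ} (hlam : ∀ i, 0 < lam i) {v : ι → E}
    (hv : Orthonormal ℝ v) {x : E} (hx : ‖x‖ = 1)
    (hmax : ∀ y : E, ‖y‖ = 1 →
      ∑ i ∈ S, lam i * ⟪v i, y⟫ ^ p ≤ ∑ i ∈ S, lam i * ⟪v i, x⟫ ^ p) :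
    ∃ k ∈ S, x = v k ∧ ∑ i ∈ S, lam i * ⟪v i, x⟫ ^ p = lam k := by
  classical
  have hval : ∀ k ∈ S, ∑ i ∈ S, lam i * ⟪v i, v k⟫ ^ p = lam k := by
    intro k hk
    rw [Finset.sum_eq_single k]
    · simp [hv.1 k]
    · intro i _ hik
      simp [hv.2 hik, show p ≠ 0 by omega]
    · exact fun h => absurd hk h
  set M := ∑ i ∈ S, lam i * ⟪v i, x⟫ ^ p with hM
  have hle : ∀ k ∈ S, lam k ≤ M := fun k hk => (hval k hk).symm.trans_le (hmax _ (hv.1 k))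
  obtain ⟨k₀, hk₀⟩ := hS
  have hMpos : 0 < M := (hlam k₀).trans_le (hle k₀ hk₀)
  have habs : ∀ i, |⟪v i, x⟫| ≤ 1 := fun i => by
    simpa [hv.1 i, hx] using abs_real_inner_le_norm (v i) x
  have hbessel : ∑ i ∈ S, ⟪v i, x⟫ ^ 2 ≤ 1 := by
    simpa [hx] using hv.sum_inner_products_le (s := S) x
  obtain ⟨q, rfl⟩ : ∃ q, p = q + 2 := ⟨p - 2, by omega⟩
  have hterm : ∀ i ∈ S, lam i * ⟪v i, x⟫ ^ (q + 2) ≤ M * ⟪v i, x⟫ ^ 2 := by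
    intro i hi
    have hpow : ⟪v i, x⟫ ^ q ≤ 1 :=
      (le_abs_self _).trans (by rw [abs_pow]; exact pow_le_one₀ (abs_nonneg _) (habs i))
    rw [pow_add, ← mul_assoc]
    refine mul_le_mul_of_nonneg_right ?_ (sq_nonneg _)
    nlinarith [hlam i, hle i hi]
  have hsum : ∑ i ∈ S, M * ⟪v i, x⟫ ^ 2 ≤ M := by
    rw [← Finset.mul_sum]
    nlinarith
  have heq : ∀ i ∈ S, lam i * ⟪v i, x⟫ ^ (q + 2) = M * ⟪v i, x⟫ ^ 2 :=
    (Finset.sum_eq_sum_iff_of_le hterm).1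
      (le_antisymm (Finset.sum_le_sum hterm) (hsum.trans hM.le))
  obtain ⟨k, hk, hne⟩ : ∃ k ∈ S, lam k * ⟪v k, x⟫ ^ (q + 2) ≠ 0 :=
    Finset.exists_ne_zero_of_sum_ne_zero (hM ▸ hMpos.ne')
  have hc : ⟪v k, x⟫ ≠ 0 := fun h => hne (by simp [h])
  have hMk : lam k * ⟪v k, x⟫ ^ q = M := by
    have h := heq k hk
    rw [pow_add, ← mul_assoc] at h
    exact mul_right_cancel₀ (pow_ne_zero 2 hc) h
  have hge : 1 ≤ ⟪v k, x⟫ ^ q := by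
    have h := hle k hk
    rw [← hMk] at h
    exact (le_mul_iff_one_le_right (hlam k)).1 h
  have hq : Odd q := by
    obtain ⟨m, hm⟩ := hodd
    exact ⟨m - 1, by omega⟩
  have hone : ⟪v k, x⟫ = 1 := by
    refine le_antisymm ((le_abs_self _).trans (habs k)) ?_
    exact hq.strictMono_pow.le_iff_le.1 (by simpa using hge)
  refine ⟨k, hk, ((inner_eq_one_iff_of_norm_eq_one (hv.1 k) hx).1 hone).symm, ?_⟩
  rw [← hMk, hone]
  simp

/-- Corollary 2.4 of the paper; Zhang–Golub. Let `p ≥ 3` be odd and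
`T = ∑ λᵢ vᵢ^⊗p` be SOD with `λᵢ > 0` and `{vᵢ}` an orthonormal basis. Apply SROA
to `T̂ := T` (no perturbation): `T̂₀ := T̂`; for `i = 0,…,n−1`, `v̂ᵢ` maximizes
`T̂ᵢ v^⊗p` over unit vectors, `λ̂ᵢ := T̂ᵢ v̂ᵢ^⊗p`, `T̂_{i+1} := T̂ᵢ − λ̂ᵢ v̂ᵢ^⊗p`. Then some
permutation `π` of the indices satisfies `λ̂ᵢ = λ_{π(i)}` and `v̂ᵢ = v_{π(i)}` for all `i`. -/
theorem sroa_exact_recovery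
    {n : ℕ} (p : ℕ) (hodd : Odd p) (hp : 3 ≤ p)
    (lam : Fin n → ℝ) (hlam : ∀ i, 0 < lam i)
    (v : Fin n → EuclideanSpace ℝ (Fin n)) (hv : Orthonormal ℝ v)
    (Th : ℕ → (Fin p → Fin n) → ℝ)
    (vh : ℕ → EuclideanSpace ℝ (Fin n)) (lamh : ℕ → ℝ)
    (hT0 : Th 0 = ∑ i, lam i • tpow p (v i))
    (hmax : ∀ i < n, ‖vh i‖ = 1 ∧
      ∀ y : EuclideanSpace ℝ (Fin n), ‖y‖ = 1 → tapply (Th i) y ≤ tapply (Th i) (vh i))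
    (hlamh : ∀ i < n, lamh i = tapply (Th i) (vh i))
    (hstep : ∀ i < n, Th (i + 1) = Th i - lamh i • tpow p (vh i)) :
    ∃ π : Equiv.Perm (Fin n), ∀ j : Fin n, lamh j = lam (π j) ∧ vh j = v (π j) := by
  classical
  set S : ℕ → Finset (Fin n) := fun j => Finset.univ.filter fun i => ∀ l < j, v i ≠ vh l with hS
  have hcomp : ∀ j < n, Th j = ∑ i ∈ S j, lam i • tpow p (v i) → (S j).card = n - j →
      ∃ k ∈ S j, vh j = v k ∧ lamh j = lam k := by
    intro j hj hT hcard
    obtain ⟨hnorm, hle⟩ := hmax j hj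
    simp only [hT, tapply_sum_smul_tpow] at hle
    rw [hlamh j hj, hT, tapply_sum_smul_tpow]
    exact exists_eq_of_isMax_sum_inner_pow hodd hp (Finset.card_pos.1 (by omega)) hlam hv
      hnorm hle
  have hinv : ∀ j ≤ n, Th j = ∑ i ∈ S j, lam i • tpow p (v i) ∧ (S j).card = n - j := by
    intro j
    induction j with
    | zero => intro _; simp [hS, hT0]
    | succ j ih =>
      intro hj
      obtain ⟨hT, hcard⟩ := ih (by omega)
      obtain ⟨k, hk, hvk, hlk⟩ := hcomp j hj hT hcard
      have herase : S (j + 1) = (S j).erase k := by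
        ext i
        simp only [hS, Finset.mem_erase, Finset.mem_filter, Finset.mem_univ, true_and,
          Nat.forall_lt_succ_right, hvk, ne_eq, hv.linearIndependent.injective.eq_iff]
        exact and_comm
      refine ⟨?_, ?_⟩
      · rw [hstep j hj, hT, herase, hvk, hlk, ← Finset.add_sum_erase _ _ hk,
          add_sub_cancel_left]
      · rw [herase, Finset.card_erase_of_mem hk, hcard]
        omega
  have hex : ∀ j : Fin n, ∃ k ∈ S j, vh j = v k ∧ lamh j = lam k := fun j =>
    hcomp j j.2 (hinv j j.2.le).1 (hinv j j.2.le).2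
  choose f hfS hfv hfl using hex
  have hne : ∀ a b : Fin n, a < b → f a ≠ f b := fun a b hab h =>
    (Finset.mem_filter.1 (hfS b)).2 a hab (by rw [hfv a, h])
  have hf : Function.Injective f := by
    intro a b h
    rcases lt_trichotomy a b with hab | hab | hab
    · exact absurd h (hne a b hab)
    · exact hab
    · exact absurd h.symm (hne b a hab)
  exact ⟨Equiv.ofBijective f (Finite.injective_iff_bijective.1 hf),
    fun j => ⟨hfl j, hfv j⟩⟩
end

section
/- For every odd integer p ≥ 3 there exists a constant c₀ = c₀(p) > 0 such that the following holds for every n. Let T̂ = T + E ∈ ⊗^p ℝ^n, where T = Σ_{i=1}^n λ_i v_i^⊗p is SOD with λ_i > 0 for all i, {v₁,…,v_n} an orthonormal basis of ℝ^n, and E is a symmetric tensor with operator norm ε := ‖E‖. Assume ε ≤ c₀ λ_min / n^{1/(p−1)}, where λ_min := min_i λ_i. Let {(λ̂_i, v̂_i)}_{i=1}^n be the output of SROA applied to T̂. Then there exists a permutation π of {1,…,n} such that for all j: |λ_{π(j)} − λ̂_j| ≤ 2ε and ‖v_{π(j)} − v̂_j‖₂ ≤ 20ε/λ_{π(j)}.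 -/
open scoped RealInnerProductSpace BigOperators

theorem deflation_term_le {q : ℕ} (hq : 2 ≤ q) {l lh a b w wh ε d : ℝ} (hε : 0 ≤ ε)
    (hl0 : 0 < l) (hl : ε ≤ l) (hlh : |l - lh| ≤ 2 * ε) (hab : |a - b| ≤ 20 * ε / l)
    (hw : |w - wh| ≤ 20 * ε / l) (hd : 20 * ε / l ≤ d) (hd1 : d ≤ 1) (ha : |a| ≤ 1) :
    |l * a ^ q * w - lh * b ^ q * wh| ≤
      2 ^ q * ε * ((20 * q + 4) * ((|a| + d ^ (q - 1)) * |w|) + 60 * (a ^ 2 + d ^ q)) := by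
  obtain ⟨r, rfl⟩ : ∃ r, q = r + 1 := ⟨q - 1, by omega⟩
  have hr : 1 ≤ r := by omega
  simp only [Nat.add_sub_cancel]
  have hd0 : 0 ≤ d := le_trans (by positivity) hd
  set m := |a| + d with hm
  have hm0 : 0 ≤ m := by positivity
  have hm2 : m ≤ 2 := by linarith
  have hb : |b| ≤ m := by
    have : |b| ≤ |a| + |a - b| := by
      have := abs_sub_abs_le_abs_sub b a
      rw [abs_sub_comm] at this; linarith
    linarith
  have ham : |a| ≤ m := by linarith
  have hle : l * (20 * ε / l) = 20 * ε := by field_simp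
  have h1 : l * |a ^ (r + 1) - b ^ (r + 1)| ≤ 20 * ε * ((r + 1) * m ^ r) := by
    have h := abs_pow_sub_pow_le a b (r + 1)
    simp only [Nat.add_sub_cancel] at h
    have hmax : max |a| |b| ^ r ≤ m ^ r := by gcongr; exact max_le ham hb
    calc l * |a ^ (r + 1) - b ^ (r + 1)|
        ≤ l * (20 * ε / l * (r + 1 : ℕ) * m ^ r) := by
          gcongr
          exact h.trans (by gcongr)
      _ = l * (20 * ε / l) * ((r + 1) * m ^ r) := by push_cast; ring
      _ = _ := by rw [hle]
  have hbq : |b ^ (r + 1)| ≤ m ^ (r + 1) := by rw [abs_pow]; gcongr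
  have h2 : |l - lh| * |b ^ (r + 1)| ≤ 4 * ε * m ^ r := by
    calc _ ≤ 2 * ε * m ^ (r + 1) := by gcongr
      _ = 2 * ε * m ^ r * m := by ring
      _ ≤ 2 * ε * m ^ r * 2 := by gcongr
      _ = _ := by ring
  have h3 : |lh| * |w - wh| ≤ 60 * ε := by
    have : |lh| ≤ 3 * l := by
      have := abs_sub_abs_le_abs_sub lh l
      rw [abs_sub_comm, abs_of_pos hl0] at this; linarith
    calc _ ≤ 3 * l * (20 * ε / l) := by gcongr
      _ = _ := by rw [mul_assoc, hle]; ring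
  have hmr : m ^ r ≤ 2 ^ (r + 1) * (|a| + d ^ r) := by
    have h := add_pow_le (abs_nonneg a) hd0 r
    calc m ^ r ≤ 2 ^ (r - 1) * (|a| ^ r + d ^ r) := h
      _ ≤ 2 ^ (r + 1) * (|a| + d ^ r) := by
        gcongr
        · norm_num
        · omega
        · exact pow_le_of_le_one (abs_nonneg a) ha (by omega)
  have hmq : m ^ (r + 1) ≤ 2 ^ (r + 1) * (a ^ 2 + d ^ (r + 1)) := by
    have h := add_pow_le (abs_nonneg a) hd0 (r + 1)
    calc m ^ (r + 1) ≤ 2 ^ (r + 1 - 1) * (|a| ^ (r + 1) + d ^ (r + 1)) := h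
      _ ≤ 2 ^ (r + 1) * (a ^ 2 + d ^ (r + 1)) := by
        gcongr
        · norm_num
        · omega
        · rw [← sq_abs]
          exact pow_le_pow_of_le_one (abs_nonneg a) ha (by omega)
  have hsplit : l * a ^ (r + 1) * w - lh * b ^ (r + 1) * wh =
      l * (a ^ (r + 1) - b ^ (r + 1)) * w + (l - lh) * b ^ (r + 1) * w
        + lh * (w - wh) * b ^ (r + 1) := by ring
  rw [hsplit]
  refine (abs_add_three _ _ _).trans ?_
  simp only [abs_mul, abs_of_pos hl0]
  have hw0 := abs_nonneg w
  calc _ ≤ 20 * ε * ((r + 1) * m ^ r) * |w| + 4 * ε * m ^ r * |w| + 60 * ε * m ^ (r + 1) := by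
        gcongr
    _ = ε * ((20 * (r + 1) + 4) * (m ^ r * |w|) + 60 * m ^ (r + 1)) := by ring
    _ ≤ ε * ((20 * (r + 1) + 4) * (2 ^ (r + 1) * (|a| + d ^ r) * |w|)
          + 60 * (2 ^ (r + 1) * (a ^ 2 + d ^ (r + 1)))) := by gcongr
    _ = _ := by push_cast; ring

theorem sum_mul_abs_le_of_sum_sq_le {ι : Type*} (A : Finset ι) {f w : ι → ℝ} {s : ℝ} (hs : 0 ≤ s)
    (hf : ∑ j ∈ A, f j ^ 2 ≤ s ^ 2) (hw : ∑ j ∈ A, w j ^ 2 ≤ 1) :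
    ∑ j ∈ A, f j * |w j| ≤ s := by
  have h := Finset.sum_mul_sq_le_sq_mul_sq A f (fun j => |w j|)
  simp only [sq_abs] at h
  refine (abs_le_of_sq_le_sq' (h.trans ?_) hs).2
  have h0 : 0 ≤ ∑ j ∈ A, w j ^ 2 := Finset.sum_nonneg fun _ _ => sq_nonneg _
  nlinarith [sq_nonneg s]

/-- The deflation errors `l a^q w - lh b^q wh`, summed over the terms already removed. -/
theorem abs_sum_deflation_le {ι : Type*} (A : Finset ι) {q : ℕ} (hq : 2 ≤ q)
    {l lh a b w wh : ι → ℝ} {ε d s τ : ℝ} (hε : 0 ≤ ε)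
    (hl0 : ∀ j ∈ A, 0 < l j) (hl : ∀ j ∈ A, ε ≤ l j) (hlh : ∀ j ∈ A, |l j - lh j| ≤ 2 * ε)
    (hab : ∀ j ∈ A, |a j - b j| ≤ 20 * ε / l j) (hw : ∀ j ∈ A, |w j - wh j| ≤ 20 * ε / l j)
    (hd : ∀ j ∈ A, 20 * ε / l j ≤ d) (hd0 : 0 ≤ d) (hd1 : d ≤ 1)
    (hcard : (A.card : ℝ) * d ^ q ≤ τ ^ 2) (hτ0 : 0 ≤ τ) (hτ1 : τ ≤ 1) (hs0 : 0 ≤ s) (hs1 : s ≤ 1)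
    (hsa : ∑ j ∈ A, a j ^ 2 ≤ s ^ 2) (hsw : ∑ j ∈ A, w j ^ 2 ≤ 1) :
    |∑ j ∈ A, (l j * a j ^ q * w j - lh j * b j ^ q * wh j)| ≤
      (20 * q + 64) * 2 ^ q * ε * (s + τ) := by
  have ha : ∀ j ∈ A, |a j| ≤ 1 := fun j hj => by
    have : a j ^ 2 ≤ s ^ 2 :=
      (Finset.single_le_sum (f := fun j => a j ^ 2) (fun _ _ => sq_nonneg _) hj).trans hsa
    exact (abs_le_of_sq_le_sq this hs0).trans hs1
  refine (Finset.abs_sum_le_sum_abs _ _).trans ((Finset.sum_le_sum fun j hj =>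
    deflation_term_le hq hε (hl0 j hj) (hl j hj) (hlh j hj) (hab j hj) (hw j hj) (hd j hj) hd1
      (ha j hj)).trans ?_)
  rw [← Finset.mul_sum, Finset.sum_add_distrib, ← Finset.mul_sum, ← Finset.mul_sum,
    Finset.sum_add_distrib]
  simp only [add_mul, Finset.sum_add_distrib]
  have h1 : ∑ j ∈ A, |a j| * |w j| ≤ s :=
    sum_mul_abs_le_of_sum_sq_le A hs0 (by simpa only [sq_abs] using hsa) hsw
  have h2 : ∑ j ∈ A, d ^ (q - 1) * |w j| ≤ τ := by
    refine sum_mul_abs_le_of_sum_sq_le A hτ0 ?_ hsw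
    rw [Finset.sum_const, nsmul_eq_mul, ← pow_mul]
    refine le_trans ?_ hcard
    gcongr ?_ * ?_
    exact pow_le_pow_of_le_one hd0 hd1 (by omega)
  have h3 : ∑ j ∈ A, d ^ q ≤ τ := by
    rw [Finset.sum_const, nsmul_eq_mul]; nlinarith
  have h4 : ∑ j ∈ A, a j ^ 2 ≤ s := by nlinarith
  calc _ ≤ 2 ^ q * ε * (20 * q * (s + τ) + 4 * (s + τ) + 60 * (s + τ)) := by
        gcongr
    _ = _ := by ring

theorem tapply_sub {p n : ℕ} (S T : (Fin p → Fin n) → ℝ) (x : EuclideanSpace ℝ (Fin n)) :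
    tapply (S - T) x = tapply S x - tapply T x := by
  simp only [tapply, Pi.sub_apply, sub_mul, Finset.sum_sub_distrib]

theorem tapply_smul {p n : ℕ} (c : ℝ) (T : (Fin p → Fin n) → ℝ) (x : EuclideanSpace ℝ (Fin n)) :
    tapply (c • T) x = c * tapply T x := by
  simp only [tapply, Pi.smul_apply, smul_eq_mul, mul_assoc, Finset.mul_sum]

theorem tapply_sum {p n : ℕ} {ι : Type*} (A : Finset ι) (T : ι → (Fin p → Fin n) → ℝ)
    (x : EuclideanSpace ℝ (Fin n)) : tapply (∑ i ∈ A, T i) x = ∑ i ∈ A, tapply (T i) x := by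
  simp only [tapply, Finset.sum_apply, Finset.sum_mul]
  exact Finset.sum_comm

theorem tnorm_nonneg {p n : ℕ} (T : (Fin p → Fin n) → ℝ) : 0 ≤ tnorm T := by
  refine Real.sSup_nonneg ?_
  rintro _ ⟨_, _, rfl⟩
  exact abs_nonneg _

theorem norm_cos_smul_add_sin_smul {V : Type*} [NormedAddCommGroup V] [InnerProductSpace ℝ V]
    {x w : V} (hx : ‖x‖ = 1) (hw : ‖w‖ = 1) (hxw : ⟪x, w⟫ = 0) (t : ℝ) :
    ‖Real.cos t • x + Real.sin t • w‖ = 1 := by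
  have h : ‖Real.cos t • x + Real.sin t • w‖ ^ 2 = 1 := by
    rw [norm_add_sq_real, norm_smul, norm_smul, inner_smul_left, inner_smul_right, hxw, hx, hw]
    simp
  exact (pow_eq_one_iff_of_nonneg (norm_nonneg _) two_ne_zero).1 h

/-- `T` applied to the `p`-th power of the complex vector `α x + β w`. -/
noncomputable def tplane {p n : ℕ} (T : (Fin p → Fin n) → ℝ) (x w : EuclideanSpace ℝ (Fin n))
    (α β : ℂ) : ℂ :=
  ∑ idx : Fin p → Fin n, (T idx : ℂ) * ∏ k, (α * x (idx k) + β * w (idx k))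

section Plane
variable {p n : ℕ} (T : (Fin p → Fin n) → ℝ) (x w : EuclideanSpace ℝ (Fin n))

theorem tplane_mul (c α β : ℂ) : tplane T x w (c * α) (c * β) = c ^ p * tplane T x w α β := by
  simp only [tplane, Finset.mul_sum]
  refine Finset.sum_congr rfl fun idx _ => ?_
  simp only [mul_assoc, ← mul_add, Finset.prod_mul_distrib, Finset.prod_const, Finset.card_univ,
    Fintype.card_fin]
  ring

theorem tplane_ofReal (α β : ℝ) : tplane T x w α β = (tapply T (α • x + β • w) : ℂ) := by
  simp [tplane, tapply]

/-- The complex polynomial `u ↦ T ((u+1)/2 x + (u-1)/(2i) w)^p`; at `u = exp (2 i t)` it equals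
`exp (i p t)` times `T` at the point of angle `t` on the great circle through `x` and `w`. -/
noncomputable def tcircle (u : ℂ) : ℂ :=
  tplane T x w ((u + 1) / 2) ((u - 1) / (2 * Complex.I))

theorem tcircle_exp (t : ℝ) :
    tcircle T x w (Complex.exp (2 * t * Complex.I)) =
      Complex.exp (t * Complex.I) ^ p * tapply T (Real.cos t • x + Real.sin t • w) := by
  rw [← tplane_ofReal, ← tplane_mul, tcircle]
  have h : Complex.exp (2 * t * Complex.I) = Complex.exp (t * Complex.I) ^ 2 := by
    rw [← Complex.exp_nat_mul]; congr 1; push_cast; ring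
  have h' : Complex.exp (t * Complex.I) * Complex.exp (-(t * Complex.I)) = 1 := by
    rw [← Complex.exp_add]; simp
  have hI := Complex.I_ne_zero
  congr 1
  · rw [Complex.ofReal_cos, Complex.cos, h, ← h', neg_mul]; ring
  · rw [Complex.ofReal_sin, Complex.sin, h, ← h', neg_mul]
    field_simp
    rw [Complex.I_sq]; ring

theorem differentiable_tcircle : Differentiable ℂ (tcircle T x w) := by
  unfold tcircle tplane
  fun_prop

theorem tcircle_inv {u : ℂ} (hu : u ≠ 0) :
    tcircle T x w u = u ^ p * tcircle T x (-w) u⁻¹ := by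
  have h : tcircle T x (-w) u⁻¹ = tplane T x w ((u⁻¹ + 1) / 2) (-((u⁻¹ - 1) / (2 * Complex.I))) := by
    simp [tcircle, tplane]
  rw [h, ← tplane_mul, tcircle]
  have hI := Complex.I_ne_zero
  congr 1 <;> field_simp <;> ring

variable {T x w}

theorem norm_tcircle_le_of_norm_eq_one (hx : ‖x‖ = 1) (hw : ‖w‖ = 1) (hxw : ⟪x, w⟫ = 0) {u : ℂ}
    (hu : ‖u‖ = 1) : ‖tcircle T x w u‖ ≤ tnorm T := by
  have h : u = Complex.exp (2 * (u.arg / 2 : ℝ) * Complex.I) := by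
    conv_lhs => rw [← Complex.norm_mul_exp_arg_mul_I u, hu]
    push_cast
    rw [one_mul]
    congr 1; ring
  rw [h, tcircle_exp, norm_mul, norm_pow, Complex.norm_exp_ofReal_mul_I, one_pow, one_mul,
    Complex.norm_real]
  exact abs_tapply_le_tnorm T (norm_cos_smul_add_sin_smul hx hw hxw _)

theorem norm_tcircle_le_of_norm_le_one (hx : ‖x‖ = 1) (hw : ‖w‖ = 1) (hxw : ⟪x, w⟫ = 0) {u : ℂ}
    (hu : ‖u‖ ≤ 1) : ‖tcircle T x w u‖ ≤ tnorm T := by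
  refine Complex.norm_le_of_forall_mem_frontier_norm_le (U := Metric.ball 0 1)
    Metric.isBounded_ball (differentiable_tcircle T x w).diffContOnCl (fun z hz => ?_) ?_
  · rw [frontier_ball _ one_ne_zero] at hz
    exact norm_tcircle_le_of_norm_eq_one hx hw hxw (by simpa using hz)
  · rw [closure_ball _ one_ne_zero]; simpa using hu

theorem norm_tcircle_le (hx : ‖x‖ = 1) (hw : ‖w‖ = 1) (hxw : ⟪x, w⟫ = 0) {u : ℂ} {r : ℝ}
    (hr : 1 ≤ r) (hu : ‖u‖ ≤ r) : ‖tcircle T x w u‖ ≤ r ^ p * tnorm T := by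
  have hT := tnorm_nonneg T
  rcases le_total ‖u‖ 1 with h | h
  · exact (norm_tcircle_le_of_norm_le_one hx hw hxw h).trans
      (le_mul_of_one_le_left hT (one_le_pow₀ hr))
  · have h0 : u ≠ 0 := by rintro rfl; norm_num at h
    rw [tcircle_inv T x w h0, norm_mul, norm_pow]
    gcongr
    refine norm_tcircle_le_of_norm_le_one hx (by simpa using hw) (by simpa using hxw) ?_
    rw [norm_inv]; exact inv_le_one_of_one_le₀ h

/-- A Bernstein-type inequality along great circles. -/
theorem exists_hasDerivAt_tapply_circle (hp : 0 < p) (hx : ‖x‖ = 1) (hw : ‖w‖ = 1)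
    (hxw : ⟪x, w⟫ = 0) :
    ∃ e : ℝ, HasDerivAt (fun t : ℝ => tapply T (Real.cos t • x + Real.sin t • w)) e 0 ∧
      |e| ≤ 7 * p * tnorm T := by
  have hT := tnorm_nonneg T
  have hp' : (0 : ℝ) < p := by exact_mod_cast hp
  have hdiff : Differentiable ℝ (fun t : ℝ => tapply T (Real.cos t • x + Real.sin t • w)) := by
    simp only [tapply, PiLp.add_apply, PiLp.smul_apply, smul_eq_mul]
    fun_prop
  refine ⟨_, (hdiff 0).hasDerivAt, ?_⟩
  set e := deriv (fun t : ℝ => tapply T (Real.cos t • x + Real.sin t • w)) 0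
  have hG : ‖deriv (tcircle T x w) 1‖ ≤ 3 * p * tnorm T := by
    have h := Complex.norm_deriv_le_of_forall_mem_sphere_norm_le (c := (1 : ℂ)) (R := (p : ℝ)⁻¹)
      (C := 3 * tnorm T) (f := tcircle T x w) (by positivity)
      (differentiable_tcircle T x w).diffContOnCl ?_
    · rw [div_inv_eq_mul] at h; linarith
    · intro z hz
      have hz' : ‖z‖ ≤ 1 + (p : ℝ)⁻¹ := by
        have : ‖z - 1‖ = (p : ℝ)⁻¹ := by simpa [dist_eq_norm] using hz
        have h := norm_add_le (1 : ℂ) (z - 1)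
        rw [this] at h; simpa using h
      refine (norm_tcircle_le hx hw hxw (by simp) hz').trans ?_
      gcongr
      calc (1 + (p : ℝ)⁻¹) ^ p ≤ Real.exp (p : ℝ)⁻¹ ^ p := by
            gcongr; linarith [Real.add_one_le_exp (p : ℝ)⁻¹]
        _ = Real.exp 1 := by rw [← Real.exp_nat_mul]; field_simp
        _ ≤ 3 := by linarith [Real.exp_one_lt_d9]
  have hcomp : HasDerivAt (fun t : ℝ => tcircle T x w (Complex.exp (2 * t * Complex.I)))
      (deriv (tcircle T x w) 1 * (2 * Complex.I)) 0 := by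
    have h1 : HasDerivAt (fun t : ℝ => Complex.exp (2 * t * Complex.I)) (2 * Complex.I) 0 := by
      have := ((((hasDerivAt_id (0 : ℝ)).ofReal_comp).const_mul (2 : ℂ)).mul_const Complex.I).cexp
      simpa using this
    have h2 : HasDerivAt (tcircle T x w) (deriv (tcircle T x w) 1)
        (Complex.exp (2 * ((0 : ℝ) : ℂ) * Complex.I)) := by
      simpa using (differentiable_tcircle T x w 1).hasDerivAt
    exact h2.comp (0 : ℝ) h1
  have hprod : HasDerivAt (fun t : ℝ => Complex.exp (t * Complex.I) ^ p *
      (tapply T (Real.cos t • x + Real.sin t • w) : ℂ))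
      (p * Complex.I * tapply T x + e) 0 := by
    have h1 : HasDerivAt (fun t : ℝ => Complex.exp (t * Complex.I)) Complex.I 0 := by
      have := (((hasDerivAt_id (0 : ℝ)).ofReal_comp).mul_const Complex.I).cexp
      simpa using this
    exact ((h1.pow p).mul (hdiff 0).hasDerivAt.ofReal_comp).congr_deriv (by simp [e])
  have heq : (p * Complex.I * tapply T x + e : ℂ) = deriv (tcircle T x w) 1 * (2 * Complex.I) := by
    refine hprod.unique ?_
    simpa only [tcircle_exp] using hcomp
  have he : ((e : ℝ) : ℂ) = deriv (tcircle T x w) 1 * (2 * Complex.I) - p * Complex.I * tapply T x := by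
    rw [← heq]; ring
  have hn : |e| = ‖((e : ℝ) : ℂ)‖ := (Complex.norm_real e).symm
  rw [hn, he]
  refine (norm_sub_le _ _).trans ?_
  have hTx := abs_tapply_le_tnorm T hx
  have : (p : ℝ) * |tapply T x| ≤ p * tnorm T := by gcongr
  simp only [norm_mul, Complex.norm_I, Complex.norm_natCast, Complex.norm_real, Real.norm_eq_abs,
    Complex.norm_ofNat, mul_one]
  linarith

end Plane

theorem exists_dominant_index {ι : Type*} {S : Finset ι} (hS : S.Nonempty) {q : ℕ} (hq : 2 ≤ q)
    (hqe : Even q) {lam a : ι → ℝ} {B : ℝ} (hlam : ∀ i, 0 < lam i)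
    (hB : ∀ i, 2 * B ≤ lam i) (ha1 : ∀ i, a i ≤ 1) (ha : ∑ i ∈ S, a i ^ 2 ≤ 1)
    (h : ∀ i ∈ S, lam i - B ≤ ∑ j ∈ S, lam j * a j ^ (q + 1)) :
    ∃ k ∈ S, 0 < a k ∧ lam k * (1 - a k) ≤ B ∧ (∀ i ∈ S, lam i ≤ 2 * lam k) ∧
      ∑ j ∈ S, lam j * a j ^ (q + 1) ≤ lam k := by
  obtain ⟨r, rfl⟩ : ∃ r, q = r + 1 := ⟨q - 1, by omega⟩
  have hr : Odd r := by
    rcases Nat.even_or_odd r with h | h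
    · exact absurd hqe (by simpa [Nat.even_add_one] using h)
    · exact h
  obtain ⟨m, hmS, hm⟩ := S.exists_max_image lam hS
  obtain ⟨k, hkS, hk⟩ := S.exists_max_image (fun j => lam j * a j ^ r) hS
  set μ := lam k * a k ^ r with hμ
  have hsum : ∑ j ∈ S, lam j * a j ^ (r + 1 + 1) ≤ μ * ∑ j ∈ S, a j ^ 2 := by
    rw [Finset.mul_sum]
    refine Finset.sum_le_sum fun j hj => ?_
    calc lam j * a j ^ (r + 1 + 1) = (lam j * a j ^ r) * a j ^ 2 := by ring
      _ ≤ μ * a j ^ 2 := by gcongr; exact hk j hj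
  have hs0 : 0 ≤ ∑ j ∈ S, a j ^ 2 := Finset.sum_nonneg fun _ _ => sq_nonneg _
  have hpos : 0 < μ * ∑ j ∈ S, a j ^ 2 := by linarith [h m hmS, hB m, hlam m]
  have hμ0 : 0 < μ := pos_of_mul_pos_left hpos hs0
  have hμ1 : μ * ∑ j ∈ S, a j ^ 2 ≤ μ := mul_le_of_le_one_right hμ0.le ha
  have hak : 0 < a k := hr.pow_pos_iff.1 (pos_of_mul_pos_right hμ0 (hlam k).le)
  have hpow : a k ^ r ≤ a k := pow_le_of_le_one hak.le (ha1 k) hr.pos.ne'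
  have hμk : μ ≤ lam k * a k := mul_le_mul_of_nonneg_left hpow (hlam k).le
  have hlk : lam k * a k ≤ lam k := mul_le_of_le_one_right (hlam k).le (ha1 k)
  have hm' := h m hmS
  have hkm := hm k hkS
  refine ⟨k, hkS, hak, ?_, fun i hi => ?_, by linarith⟩
  · linarith
  · linarith [hm i hi, hB m]

theorem sin_le_of_critical {q : ℕ} {a s σ l ε : ℝ} (ha0 : 0 ≤ a) (ha1 : a ≤ 1) (hs : 0 ≤ s)
    (hsa : s ^ 2 = 1 - a ^ 2) (hsσ : s ≤ σ) (hσ : (q + 1) * σ ≤ 1 / 16) (hl : 0 < l) (hε : 0 ≤ ε)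
    (h : l * a ^ q * s ≤ 8 * ε + 2 * l * s ^ 2) : l * s ≤ 11 * ε := by
  have hq0 : (0 : ℝ) ≤ q := Nat.cast_nonneg q
  have h1 : 1 - a ≤ s ^ 2 := by nlinarith
  have hs1 : s ≤ 1 / 16 := by nlinarith
  have hqs : q * s ≤ 1 / 16 := by nlinarith
  have hpow := one_add_mul_le_pow (a := a - 1) (by linarith) q
  rw [add_sub_cancel] at hpow
  have h2 : (q : ℝ) * (1 - a) ≤ 1 / 16 := by
    calc (q : ℝ) * (1 - a) ≤ q * s ^ 2 := by gcongr
      _ = q * s * s := by ring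
      _ ≤ 1 / 16 * 1 := by gcongr; linarith
      _ = _ := by ring
  have h3 : 3 / 4 ≤ a ^ q - 2 * s := by linarith
  have hls : 0 ≤ l * s := by positivity
  have h4 : l * s * (a ^ q - 2 * s) ≤ 8 * ε := by linarith
  nlinarith

section Step

variable {V : Type*} [NormedAddCommGroup V] [InnerProductSpace ℝ V] {ι κ : Type*}

theorem sum_inner_comp_sq_le {v : ι → V} (hv : Orthonormal ℝ v) {A : Finset κ} {g : κ → ι}
    (hg : Set.InjOn g A) {y : V} (hy : ‖y‖ = 1) : ∑ j ∈ A, ⟪v (g j), y⟫ ^ 2 ≤ 1 := by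
  classical
  have h := hv.sum_inner_products_le y (s := A.image g)
  rw [Finset.sum_image hg] at h
  simpa [hy] using h

theorem abs_sum_deflation_inner_le {v : ι → V} (hv : Orthonormal ℝ v) {A : Finset κ} {g : κ → ι}
    (hg : Set.InjOn g A) {q : ℕ} (hq : 2 ≤ q) {lam : ι → ℝ} {lh : κ → ℝ} {vh : κ → V} {ε τ d : ℝ}
    (hε : 0 ≤ ε) (hlam : ∀ i, 0 < lam i) (hd : ∀ i, 20 * ε ≤ d * lam i) (hd0 : 0 ≤ d)
    (hd1 : d ≤ 1) (hcard : (A.card : ℝ) * d ^ q ≤ τ ^ 2) (hτ0 : 0 ≤ τ) (hτ1 : τ ≤ 1)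
    (hlh : ∀ j ∈ A, |lam (g j) - lh j| ≤ 2 * ε)
    (hvh : ∀ j ∈ A, ‖v (g j) - vh j‖ ≤ 20 * ε / lam (g j)) {y w : V} (hy : ‖y‖ = 1) (hw : ‖w‖ = 1)
    {s : ℝ} (hs0 : 0 ≤ s) (hs1 : s ≤ 1) (hs : ∑ j ∈ A, ⟪v (g j), y⟫ ^ 2 ≤ s ^ 2) :
    |∑ j ∈ A, (lam (g j) * ⟪v (g j), y⟫ ^ q * ⟪v (g j), w⟫ - lh j * ⟪vh j, y⟫ ^ q * ⟪vh j, w⟫)| ≤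
      (20 * q + 64) * 2 ^ q * ε * (s + τ) := by
  have hin : ∀ u : V, ‖u‖ = 1 → ∀ j ∈ A, |⟪v (g j), u⟫ - ⟪vh j, u⟫| ≤ 20 * ε / lam (g j) := by
    intro u hu j hj
    rw [← inner_sub_left]
    refine (abs_real_inner_le_norm _ _).trans ?_
    rw [hu, mul_one]; exact hvh j hj
  refine abs_sum_deflation_le A hq hε (fun j _ => hlam _) (fun j _ => ?_) hlh (hin y hy) (hin w hw)
    (fun j _ => ?_) hd0 hd1 hcard hτ0 hτ1 hs0 hs1 hs (sum_inner_comp_sq_le hv hg hw)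
  · nlinarith [hd (g j), hlam (g j)]
  · rw [div_le_iff₀ (hlam _)]; exact hd _

theorem hasDerivAt_inner_circle_pow (u x w : V) (q : ℕ) :
    HasDerivAt (fun t : ℝ => ⟪u, Real.cos t • x + Real.sin t • w⟫ ^ (q + 1))
      ((q + 1) * (⟪u, x⟫ ^ q * ⟪u, w⟫)) 0 := by
  have h : HasDerivAt (fun t : ℝ => Real.cos t * ⟪u, x⟫ + Real.sin t * ⟪u, w⟫) ⟪u, w⟫ 0 := by
    simpa using ((Real.hasDerivAt_cos 0).mul_const ⟪u, x⟫).fun_add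
      ((Real.hasDerivAt_sin 0).mul_const ⟪u, w⟫)
  simp only [inner_add_right, real_inner_smul_right]
  refine (h.fun_pow (q + 1)).congr_deriv ?_
  simp; ring

/-- The derivative of `H` along the great circle from a maximizer `x` towards `w` vanishes. -/
theorem abs_sum_le_of_isMax {v : ι → V} {S : Finset ι} {A : Finset κ} {g : κ → ι} {q : ℕ}
    {lam : ι → ℝ} {lh : κ → ℝ} {vh : κ → V} {E H : V → ℝ} {ε : ℝ}
    (hH : ∀ y, H y = ∑ i ∈ S, lam i * ⟪v i, y⟫ ^ (q + 1) + E y +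
      ∑ j ∈ A, (lam (g j) * ⟪v (g j), y⟫ ^ (q + 1) - lh j * ⟪vh j, y⟫ ^ (q + 1)))
    {x w : V} (hx : ‖x‖ = 1) (hw : ‖w‖ = 1) (hxw : ⟪x, w⟫ = 0)
    (hmax : ∀ y, ‖y‖ = 1 → H y ≤ H x)
    (hE : ∃ e : ℝ, HasDerivAt (fun t : ℝ => E (Real.cos t • x + Real.sin t • w)) e 0 ∧
      |e| ≤ 7 * (q + 1) * ε)
    (hD : |∑ j ∈ A, (lam (g j) * ⟪v (g j), x⟫ ^ q * ⟪v (g j), w⟫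
      - lh j * ⟪vh j, x⟫ ^ q * ⟪vh j, w⟫)| ≤ ε) :
    |∑ i ∈ S, lam i * (⟪v i, x⟫ ^ q * ⟪v i, w⟫)| ≤ 8 * ε := by
  obtain ⟨e, he, hee⟩ := hE
  have hderiv : HasDerivAt (fun t : ℝ => H (Real.cos t • x + Real.sin t • w))
      (∑ i ∈ S, lam i * ((q + 1) * (⟪v i, x⟫ ^ q * ⟪v i, w⟫)) + e +
        ∑ j ∈ A, (lam (g j) * ((q + 1) * (⟪v (g j), x⟫ ^ q * ⟪v (g j), w⟫)) -
          lh j * ((q + 1) * (⟪vh j, x⟫ ^ q * ⟪vh j, w⟫)))) 0 := by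
    simp only [hH]
    exact ((HasDerivAt.fun_sum fun i _ =>
      (hasDerivAt_inner_circle_pow (v i) x w q).const_mul (lam i)).fun_add he).fun_add
      (HasDerivAt.fun_sum fun j _ =>
        ((hasDerivAt_inner_circle_pow (v (g j)) x w q).const_mul (lam (g j))).fun_sub
        ((hasDerivAt_inner_circle_pow (vh j) x w q).const_mul (lh j)))
  have hzero := IsLocalMax.hasDerivAt_eq_zero (Filter.Eventually.of_forall fun t => by
    simpa using hmax _ (norm_cos_smul_add_sin_smul hx hw hxw t)) hderiv
  set P := ∑ i ∈ S, lam i * (⟪v i, x⟫ ^ q * ⟪v i, w⟫) with hP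
  set Q := ∑ j ∈ A, (lam (g j) * ⟪v (g j), x⟫ ^ q * ⟪v (g j), w⟫
      - lh j * ⟪vh j, x⟫ ^ q * ⟪vh j, w⟫) with hQ
  have hPQ : (q + 1) * P + e + (q + 1) * Q = 0 := by
    rw [← hzero, hP, hQ, Finset.mul_sum, Finset.mul_sum]
    congr 1
    · congr 1
      exact Finset.sum_congr rfl fun i _ => by ring
    · exact Finset.sum_congr rfl fun j _ => by ring
  have hq1 : (0 : ℝ) < q + 1 := by positivity
  have hPabs : (q + 1) * |P| ≤ (q + 1) * (8 * ε) := by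
    have hPe : (q + 1) * P = -e + -((q + 1) * Q) := by linarith
    rw [← abs_of_pos hq1, ← abs_mul, abs_of_pos hq1, hPe]
    refine (abs_add_le _ _).trans ?_
    rw [abs_neg, abs_neg, abs_mul, abs_of_pos hq1]
    nlinarith
  exact le_of_mul_le_mul_left hPabs hq1

/-- Consequence of first-order optimality along the great circle from `x` towards `v k`. -/
theorem critical_bound {v : ι → V} (hv : Orthonormal ℝ v) {S : Finset ι} {q : ℕ} (hq : 2 ≤ q)
    {lam : ι → ℝ} (hlam : ∀ i, 0 < lam i) {x w : V} (hx : ‖x‖ = 1) {k : ι} (hk : k ∈ S) {a s : ℝ}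
    (ha : a = ⟪v k, x⟫) (ha0 : 0 ≤ a) (ha1 : a ≤ 1) (hs : 0 < s) (hsa : s ^ 2 = 1 - a ^ 2)
    (hwx : v k = a • x + s • w) (hS : ∀ i ∈ S, lam i ≤ 2 * lam k)
    {δ : ℝ} (hδ : |∑ i ∈ S, lam i * (⟪v i, x⟫ ^ q * ⟪v i, w⟫)| ≤ δ) :
    lam k * a ^ q * s ≤ δ + 2 * lam k * s ^ 2 := by
  classical
  have hs1 : s ≤ 1 := by nlinarith [sq_nonneg a]
  have hinner : ∀ i, s * ⟪v i, w⟫ = ⟪v i, v k⟫ - a * ⟪v i, x⟫ := fun i => by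
    rw [hwx, inner_add_right, real_inner_smul_right, real_inner_smul_right]; ring
  have hkk : ⟪v k, w⟫ = s := by
    have h := hinner k
    rw [real_inner_self_eq_norm_sq, hv.1 k, ← ha] at h
    have : s * ⟪v k, w⟫ = s * s := by linarith
    exact mul_left_cancel₀ hs.ne' this
  have hsum := hv.sum_inner_products_le x (s := S)
  simp only [Real.norm_eq_abs, sq_abs, hx] at hsum
  rw [← Finset.add_sum_erase _ _ hk, ← ha] at hsum
  rw [← Finset.add_sum_erase _ _ hk, ← ha, hkk] at hδ
  have hrest : ∑ i ∈ S.erase k, ⟪v i, x⟫ ^ 2 ≤ s ^ 2 := by linarith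
  have hbound : |∑ i ∈ S.erase k, lam i * (⟪v i, x⟫ ^ q * ⟪v i, w⟫)| ≤ 2 * lam k * s ^ 2 := by
    calc _ ≤ ∑ i ∈ S.erase k, |lam i * (⟪v i, x⟫ ^ q * ⟪v i, w⟫)| := Finset.abs_sum_le_sum_abs _ _
      _ ≤ ∑ i ∈ S.erase k, 2 * lam k * ⟪v i, x⟫ ^ 2 := by
        refine Finset.sum_le_sum fun i hi => ?_
        obtain ⟨hik, hiS⟩ := Finset.mem_erase.1 hi
        have hi0 : ⟪v i, v k⟫ = 0 := hv.2 hik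
        have his : |⟪v i, x⟫| ≤ s := by
          refine abs_le_of_sq_le_sq ?_ hs.le
          exact (Finset.single_le_sum (f := fun i => ⟪v i, x⟫ ^ 2)
            (fun _ _ => sq_nonneg _) hi).trans hrest
        have hiw : |⟪v i, w⟫| ≤ 1 := by
          have h := hinner i
          rw [hi0] at h
          have h' : s * |⟪v i, w⟫| = a * |⟪v i, x⟫| := by
            rw [← abs_of_pos hs, ← abs_mul, h, zero_sub, abs_neg, abs_mul, abs_of_nonneg ha0]
          have : s * |⟪v i, w⟫| ≤ s * 1 := by
            rw [h']; nlinarith [abs_nonneg ⟪v i, x⟫]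
          exact le_of_mul_le_mul_left this hs
        rw [abs_mul, abs_mul, abs_pow, abs_of_pos (hlam i)]
        have h1 : |⟪v i, x⟫| ^ q ≤ ⟪v i, x⟫ ^ 2 := by
          rw [← sq_abs ⟪v i, x⟫]
          exact pow_le_pow_of_le_one (abs_nonneg _) (his.trans hs1) hq
        have h2 := hS i hiS
        have := (hlam i).le
        have := (hlam k).le
        calc lam i * (|⟪v i, x⟫| ^ q * |⟪v i, w⟫|)
            ≤ 2 * lam k * (⟪v i, x⟫ ^ 2 * 1) := by gcongr
          _ = _ := by ring
      _ = 2 * lam k * ∑ i ∈ S.erase k, ⟪v i, x⟫ ^ 2 := by rw [Finset.mul_sum]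
      _ ≤ _ := by have := (hlam k).le; gcongr
  have h1 := (abs_le.1 hδ).2
  have h2 := (abs_le.1 hbound).1
  linarith

set_option maxHeartbeats 800000 in
/-- One step of SROA: the maximizer of the deflated tensor is close to a remaining component. -/
theorem rank_one_step [DecidableEq ι] {v : ι → V} (hv : Orthonormal ℝ v) {S : Finset ι}
    (hS : S.Nonempty) {A : Finset κ} {g : κ → ι} (hg : Set.InjOn g A) (hgS : ∀ j ∈ A, g j ∉ S)
    {q : ℕ} (hq : 2 ≤ q) (hqe : Even q) {lam : ι → ℝ} {lh : κ → ℝ} {vh : κ → V} {ε C σ τ d : ℝ}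
    (hC : C = (20 * q + 64) * 2 ^ q) (hσ : 16 * C * (q + 1) * σ = 1) (hτ : 2 * C * τ = σ ^ 2)
    (hε : 0 ≤ ε) (hlam : ∀ i, 0 < lam i) (hd : ∀ i, 20 * ε ≤ d * lam i) (hd0 : 0 ≤ d) (hdτ : d ≤ τ)
    (hcard : (A.card : ℝ) * d ^ q ≤ τ ^ 2) (hlh : ∀ j ∈ A, |lam (g j) - lh j| ≤ 2 * ε)
    (hvh : ∀ j ∈ A, ‖v (g j) - vh j‖ ≤ 20 * ε / lam (g j)) {E : V → ℝ}
    (hE : ∀ y, ‖y‖ = 1 → |E y| ≤ ε)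
    (hE' : ∀ y w, ‖y‖ = 1 → ‖w‖ = 1 → ⟪y, w⟫ = 0 → ∃ e : ℝ,
      HasDerivAt (fun t : ℝ => E (Real.cos t • y + Real.sin t • w)) e 0 ∧ |e| ≤ 7 * (q + 1) * ε)
    {H : V → ℝ} (hH : ∀ y, H y = ∑ i ∈ S, lam i * ⟪v i, y⟫ ^ (q + 1) + E y +
      ∑ j ∈ A, (lam (g j) * ⟪v (g j), y⟫ ^ (q + 1) - lh j * ⟪vh j, y⟫ ^ (q + 1)))
    {x : V} (hx : ‖x‖ = 1) (hmax : ∀ y, ‖y‖ = 1 → H y ≤ H x) :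
    ∃ k ∈ S, |lam k - H x| ≤ 2 * ε ∧ ‖v k - x‖ ≤ 20 * ε / lam k := by
  have hq2 : (2 : ℝ) ≤ q := by exact_mod_cast hq
  have hC1 : 1 ≤ C := by
    rw [hC]
    have : (1 : ℝ) ≤ 2 ^ q := one_le_pow₀ (by norm_num)
    nlinarith
  have hσ0 : 0 < σ := by
    have h : 0 < 16 * C * (q + 1) := by positivity
    exact pos_of_mul_pos_right (by rw [hσ]; exact one_pos) h.le
  have hCσ : C * σ ≤ 1 / 48 := by
    have : 0 ≤ C * σ := by positivity
    nlinarith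
  have hqσ : (q + 1) * σ ≤ 1 / 16 := by
    have : 0 ≤ (q + 1) * σ := by positivity
    nlinarith
  have hσ1 : σ ≤ 1 / 48 := by nlinarith
  have hτ0 : 0 < τ := by
    have h : 0 < 2 * C := by positivity
    exact pos_of_mul_pos_right (by rw [hτ]; positivity) h.le
  have hτσ : τ ≤ σ := by nlinarith
  have hD : ∀ y w : V, ‖y‖ = 1 → ‖w‖ = 1 → ∀ s : ℝ, 0 ≤ s → s ≤ 1 →
      ∑ j ∈ A, ⟪v (g j), y⟫ ^ 2 ≤ s ^ 2 → |∑ j ∈ A, (lam (g j) * ⟪v (g j), y⟫ ^ q * ⟪v (g j), w⟫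
        - lh j * ⟪vh j, y⟫ ^ q * ⟪vh j, w⟫)| ≤ C * ε * (s + τ) := by
    intro y w hy hw s hs0 hs1 hs
    rw [hC]
    exact abs_sum_deflation_inner_le hv hg hq hε hlam hd hd0 (by linarith) hcard hτ0.le
      (by linarith) hlh hvh hy hw hs0 hs1 hs
  have hCε : 0 ≤ C * ε := by positivity
  have hH' : ∀ y, ‖y‖ = 1 → ∀ s : ℝ, 0 ≤ s → s ≤ 1 → ∑ j ∈ A, ⟪v (g j), y⟫ ^ 2 ≤ s ^ 2 →
      |H y - ∑ i ∈ S, lam i * ⟪v i, y⟫ ^ (q + 1)| ≤ ε + C * ε * (s + τ) := by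
    intro y hy s hs0 hs1 hs
    have h1 := hD y y hy hy s hs0 hs1 hs
    simp only [mul_assoc, ← pow_succ] at h1
    rw [hH, add_assoc, add_sub_cancel_left]
    refine (abs_add_le _ _).trans (add_le_add (hE y hy) ?_)
    simpa only [mul_assoc] using h1
  have hvk : ∀ i ∈ S, lam i - 2 * ε ≤ H (v i) := by
    intro i hi
    have hA0 : ∑ j ∈ A, ⟪v (g j), v i⟫ ^ 2 ≤ (0 : ℝ) ^ 2 := by
      rw [Finset.sum_eq_zero]
      · simp
      · intro j hj
        have hne : g j ≠ i := fun h => hgS j hj (by rwa [h])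
        rw [hv.2 hne]; simp
    have h := (abs_le.1 (hH' (v i) (hv.1 i) 0 le_rfl zero_le_one hA0)).1
    have hs : ∑ j ∈ S, lam j * ⟪v j, v i⟫ ^ (q + 1) = lam i := by
      rw [Finset.sum_eq_single_of_mem i hi, real_inner_self_eq_norm_sq, hv.1 i]
      · simp
      · intro j _ hj
        rw [hv.2 hj]; simp
    rw [hs] at h
    nlinarith
  have hεσ : ∀ i, 20 * ε * C ≤ lam i * (σ ^ 2 / 2) := fun i => by
    have := (hlam i).le
    calc 20 * ε * C ≤ τ * lam i * C := by
          refine mul_le_mul_of_nonneg_right ((hd i).trans ?_) (by linarith)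
          gcongr
      _ = lam i * (2 * C * τ / 2) := by ring
      _ = _ := by rw [hτ]
  have hσsq : σ ^ 2 ≤ 1 := pow_le_one₀ hσ0.le (by linarith)
  have ha1 : ∀ i, ⟪v i, x⟫ ≤ 1 := fun i => by
    simpa [hv.1 i, hx] using real_inner_le_norm (v i) x
  have hb : ∀ B : Finset ι, ∑ i ∈ B, ⟪v i, x⟫ ^ 2 ≤ 1 := fun B => by
    simpa [hx] using hv.sum_inner_products_le x (s := B)
  obtain ⟨k, hkS, hak, hkB, hk2, hksum⟩ := exists_dominant_index hS hq hqe (lam := lam)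
    (a := fun i => ⟪v i, x⟫) (B := 6 * C * ε) hlam (fun i => by
      nlinarith [hεσ i, mul_le_of_le_one_right (hlam i).le hσsq]) ha1 (hb S) (fun i hi => by
      have h1 := hvk i hi
      have h2 := hmax (v i) (hv.1 i)
      have h3 := (abs_le.1 (hH' x hx 1 zero_le_one le_rfl (by
        simpa using sum_inner_comp_sq_le hv hg hx))).2
      nlinarith)
  set a := ⟪v k, x⟫ with ha
  have hak1 : a ≤ 1 := ha1 k
  have hl := hlam k
  have ha2 : 1 - a ≤ σ ^ 2 / 2 := by
    have : lam k * (1 - a) ≤ lam k * (σ ^ 2 / 2) := by linarith [hεσ k]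
    exact le_of_mul_le_mul_left this hl
  set s := Real.sqrt (1 - a ^ 2) with hs
  have hs0 : 0 ≤ s := Real.sqrt_nonneg _
  have hss : s ^ 2 = 1 - a ^ 2 := Real.sq_sqrt (by nlinarith)
  have hsσ : s ≤ σ := abs_le_of_sq_le_sq' (by nlinarith) hσ0.le |>.2
  have hAs : ∑ j ∈ A, ⟪v (g j), x⟫ ^ 2 ≤ s ^ 2 := by
    have h := hb (insert k (A.image g))
    rw [Finset.sum_insert, Finset.sum_image hg, ← ha] at h
    · linarith
    · intro hmem
      obtain ⟨j, hj, rfl⟩ := Finset.mem_image.1 hmem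
      exact hgS j hj hkS
  have hCs : C * (s + τ) ≤ 1 / 2 := by nlinarith
  have hDs : C * ε * (s + τ) ≤ ε / 2 := by nlinarith
  refine ⟨k, hkS, ?_, ?_⟩
  · have h1 := (hvk k hkS).trans (hmax _ (hv.1 k))
    have h2 := (abs_le.1 (hH' x hx s hs0 (by linarith) hAs)).2
    rw [abs_le]
    constructor <;> linarith
  have hdist : ‖v k - x‖ ^ 2 = 2 * (1 - a) := by
    rw [norm_sub_sq_real, hv.1 k, hx, ← ha]; ring
  have hls : lam k * s ≤ 11 * ε := by
    rcases hs0.eq_or_lt with h0 | hspos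
    · rw [← h0]; simpa using hε
    refine sin_le_of_critical hak.le hak1 hs0 hss hsσ hqσ hl hε ?_
    set w := s⁻¹ • (v k - a • x) with hw
    have hwx : v k = a • x + s • w := by
      rw [hw, smul_inv_smul₀ hspos.ne']; abel
    have hxw : ⟪x, w⟫ = 0 := by
      rw [hw, real_inner_smul_right, inner_sub_right, real_inner_smul_right,
        real_inner_self_eq_norm_sq, hx, real_inner_comm, ← ha]; ring
    have hw1 : ‖w‖ = 1 := by
      have h : ‖v k - a • x‖ ^ 2 = s ^ 2 := by
        rw [norm_sub_sq_real, norm_smul, real_inner_smul_right, ← ha, hv.1 k, hx, mul_one,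
          Real.norm_eq_abs, sq_abs, hss]; ring
      rw [hw, norm_smul, (pow_left_inj₀ (norm_nonneg _) hs0 two_ne_zero).1 h, norm_inv,
        Real.norm_of_nonneg hs0, inv_mul_cancel₀ hspos.ne']
    exact critical_bound hv hq hlam hx hkS ha hak.le hak1 hspos hss hwx hk2
      (abs_sum_le_of_isMax hH hx hw1 hxw hmax (hE' x w hx hw1 hxw)
        (by linarith [hD x w hx hw1 s hs0 (by linarith) hAs]))
  rw [le_div_iff₀ hl]
  have h1 : ‖v k - x‖ ≤ 3 / 2 * s :=
    abs_le_of_sq_le_sq' (by nlinarith) (by positivity) |>.2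
  nlinarith

end Step

/-- The tensor left after `i` steps of SROA. -/
theorem tapply_sroa {p n : ℕ} {lam : Fin n → ℝ} {v : Fin n → EuclideanSpace ℝ (Fin n)}
    {E : (Fin p → Fin n) → ℝ} {Th : ℕ → (Fin p → Fin n) → ℝ} {vh : ℕ → EuclideanSpace ℝ (Fin n)}
    {lamh : ℕ → ℝ} (h0 : Th 0 = (∑ i, lam i • tpow p (v i)) + E)
    (hTh : ∀ i < n, Th (i + 1) = Th i - lamh i • tpow p (vh i)) {i : ℕ} (hi : i ≤ n)
    (y : EuclideanSpace ℝ (Fin n)) :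
    tapply (Th i) y = ∑ k, lam k * ⟪v k, y⟫ ^ p + tapply E y
      - ∑ j ∈ Finset.range i, lamh j * ⟪vh j, y⟫ ^ p := by
  induction i with
  | zero => simp [h0, tapply_add, tapply_sum, tapply_smul, tapply_tpow]
  | succ i ih =>
    rw [hTh i hi, tapply_sub, ih (by omega), tapply_smul, tapply_tpow, Finset.sum_range_succ]
    ring

/-- Theorem 3.1 of the paper. For every odd `p ≥ 3` there is a constant
`c₀ = c₀(p) > 0` such that: for every `n`, if `T̂ = ∑ λᵢ vᵢ^⊗p + E` with `{vᵢ}` orthonormal,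
`λᵢ > 0`, `E` symmetric of operator norm `ε` with `ε ≤ c₀ λ_min / n^{1/(p−1)}`, and
`{(λ̂ᵢ, v̂ᵢ)}` is the output of SROA on `T̂`, then some permutation `π` satisfies
`|λ_{π(j)} − λ̂ⱼ| ≤ 2ε` and `‖v_{π(j)} − v̂ⱼ‖₂ ≤ 20 ε / λ_{π(j)}` for all `j`. -/
theorem sroa_full_decomposition (p : ℕ) (hodd : Odd p) (hp : 3 ≤ p) :
    ∃ c₀ : ℝ, 0 < c₀ ∧
      ∀ (n : ℕ) (lam : Fin n → ℝ) (v : Fin n → EuclideanSpace ℝ (Fin n))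
        (E : (Fin p → Fin n) → ℝ) (ε : ℝ)
        (Th : ℕ → (Fin p → Fin n) → ℝ)
        (vh : ℕ → EuclideanSpace ℝ (Fin n)) (lamh : ℕ → ℝ),
        (∀ i, 0 < lam i) →
        Orthonormal ℝ v →
        tsymm E →
        ε = tnorm E →
        ε ≤ c₀ * (⨅ i, lam i) / (n : ℝ) ^ ((1 : ℝ) / ((p : ℝ) - 1)) →
        Th 0 = (∑ i, lam i • tpow p (v i)) + E →
        (∀ i < n, ‖vh i‖ = 1 ∧
          ∀ y : EuclideanSpace ℝ (Fin n), ‖y‖ = 1 → tapply (Th i) y ≤ tapply (Th i) (vh i)) →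
        (∀ i < n, lamh i = tapply (Th i) (vh i)) →
        (∀ i < n, Th (i + 1) = Th i - lamh i • tpow p (vh i)) →
        ∃ π : Equiv.Perm (Fin n), ∀ j : Fin n,
          |lam (π j) - lamh j| ≤ 2 * ε ∧ ‖v (π j) - vh j‖ ≤ 20 * ε / lam (π j) := by
  obtain ⟨q, rfl⟩ : ∃ q, p = q + 1 := ⟨p - 1, by omega⟩
  have hq : 2 ≤ q := by omega
  have hqe : Even q := by
    rcases Nat.even_or_odd q with h | h
    · exact h
    · exact absurd hodd (by simpa [Nat.odd_add_one] using h)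
  obtain ⟨C, hC⟩ : ∃ C : ℝ, C = (20 * q + 64) * 2 ^ q := ⟨_, rfl⟩
  have hC0 : 1 ≤ C := by
    rw [hC]
    have h1 : (1 : ℝ) ≤ 2 ^ q := one_le_pow₀ (by norm_num)
    have h2 : (0 : ℝ) ≤ q := Nat.cast_nonneg q
    nlinarith
  obtain ⟨σ, hσ⟩ : ∃ σ : ℝ, 16 * C * (q + 1) * σ = 1 :=
    ⟨(16 * C * (q + 1))⁻¹, mul_inv_cancel₀ (by positivity)⟩
  have hσ0 : 0 < σ :=
    pos_of_mul_pos_right (by rw [hσ]; exact one_pos) (show 0 ≤ 16 * C * (q + 1) by positivity)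
  have hσ1 : σ ≤ 1 := by
    have : 1 ≤ 16 * C * (q + 1) := by nlinarith [(Nat.cast_nonneg q : (0 : ℝ) ≤ q)]
    nlinarith
  obtain ⟨τ, hτ⟩ : ∃ τ : ℝ, 2 * C * τ = σ ^ 2 :=
    ⟨(2 * C)⁻¹ * σ ^ 2, mul_inv_cancel_left₀ (by positivity) _⟩
  have hτ0 : 0 < τ :=
    pos_of_mul_pos_right (by rw [hτ]; positivity) (show 0 ≤ 2 * C by positivity)
  have hτ1 : τ ≤ 1 := by nlinarith
  refine ⟨τ / 20, by positivity, ?_⟩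
  intro n lam v E ε Th vh lamh hlam hv _ hεE hεle h0 hmax hlamh hTh
  rcases Nat.eq_zero_or_pos n with rfl | hn
  · exact ⟨1, fun j => j.elim0⟩
  have hε : 0 ≤ ε := hεE ▸ tnorm_nonneg E
  have hn1 : (1 : ℝ) ≤ n := by exact_mod_cast hn
  have hexp : (1 : ℝ) / (((q + 1 : ℕ) : ℝ) - 1) = (q : ℝ)⁻¹ := by push_cast; simp
  rw [hexp] at hεle
  set N := (n : ℝ) ^ (q : ℝ)⁻¹ with hN
  have hN1 : 1 ≤ N := Real.one_le_rpow hn1 (by positivity)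
  have hNq : N ^ q = n := Real.rpow_inv_natCast_pow (by positivity) (by omega)
  have hd : ∀ i, 20 * ε ≤ τ / N * lam i := fun i => by
    have h1 : (⨅ i, lam i) ≤ lam i := ciInf_le (Set.finite_range lam).bddBelow i
    calc 20 * ε ≤ 20 * (τ / 20 * (⨅ i, lam i) / N) := by gcongr
      _ = τ / N * ⨅ i, lam i := by ring
      _ ≤ _ := by gcongr
  have hcard : (n : ℝ) * (τ / N) ^ q ≤ τ ^ 2 := by
    rw [div_pow, hNq, mul_div_cancel₀ _ (by positivity)]
    exact pow_le_pow_of_le_one hτ0.le hτ1 hq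
  have key : ∀ i ≤ n, ∃ g : ℕ → Fin n, Set.InjOn g (Finset.range i) ∧ ∀ j ∈ Finset.range i,
      |lam (g j) - lamh j| ≤ 2 * ε ∧ ‖v (g j) - vh j‖ ≤ 20 * ε / lam (g j) := by
    intro i hi
    induction i with
    | zero => exact ⟨fun _ => ⟨0, hn⟩, by simp, by simp⟩
    | succ i ih =>
      obtain ⟨g, hg, hgb⟩ := ih (by omega)
      set A := Finset.range i with hA
      have hcA : (A.image g).card = i := by
        rw [Finset.card_image_of_injOn hg, hA, Finset.card_range]
      have hS : (A.image g)ᶜ.Nonempty := by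
        rw [← Finset.card_pos, Finset.card_compl, hcA, Fintype.card_fin]; omega
      obtain ⟨hx, hxmax⟩ := hmax i (by omega)
      obtain ⟨k, hkS, hk1, hk2⟩ := rank_one_step hv hS hg
        (fun j hj h => Finset.mem_compl.1 h (Finset.mem_image_of_mem g hj)) hq hqe hC hσ hτ hε hlam
        hd (by positivity) (div_le_self hτ0.le hN1)
        ((mul_le_mul_of_nonneg_right (by rw [hA, Finset.card_range]; exact_mod_cast by omega)
          (by positivity)).trans hcard)
        (fun j hj => (hgb j hj).1) (fun j hj => (hgb j hj).2) (E := tapply E)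
        (fun y hy => hεE ▸ abs_tapply_le_tnorm E hy)
        (fun y w hy hw hyw => by
          simpa [hεE] using exists_hasDerivAt_tapply_circle (T := E) q.succ_pos hy hw hyw)
        (H := tapply (Th i))
        (fun y => by
          rw [tapply_sroa h0 hTh (by omega) y, Finset.sum_sub_distrib,
            ← Finset.sum_image (f := fun k => lam k * ⟪v k, y⟫ ^ (q + 1)) hg,
            ← Finset.sum_compl_add_sum (A.image g)]
          ring)
        hx hxmax
      rw [← hlamh i (by omega)] at hk1
      have hupd : ∀ j ∈ A, Function.update g i k j = g j := fun j hj =>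
        Function.update_of_ne (Finset.mem_range.1 hj).ne k g
      refine ⟨Function.update g i k, ?_, ?_⟩
      · rw [Finset.range_add_one, Finset.coe_insert, Set.injOn_insert (by simp)]
        refine ⟨hg.congr fun j hj => (hupd j hj).symm, ?_⟩
        rintro ⟨j, hj, hjk⟩
        rw [hupd j hj, Function.update_self] at hjk
        exact Finset.mem_compl.1 hkS (Finset.mem_image.2 ⟨j, hj, hjk⟩)
      · intro j hj
        rw [Finset.range_add_one, Finset.mem_insert] at hj
        rcases hj with rfl | hj
        · rw [Function.update_self]; exact ⟨hk1, hk2⟩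
        · rw [hupd j hj]; exact hgb j hj
  obtain ⟨g, hg, hgb⟩ := key n le_rfl
  have hinj : Function.Injective fun j : Fin n => g j := fun a b hab =>
    Fin.ext (hg (by simp) (by simp) hab)
  exact ⟨Equiv.ofBijective _ (Finite.injective_iff_bijective.1 hinj), fun j =>
    hgb j (by simp)⟩
end

section
/- Let p ≥ 3 be an integer, {v₁,…,v_n} an orthonormal basis of ℝ^n, and λ_i > 0 for i ∈ S ⊆ {1,…,n}. Assume 0 ≤ ε̂ ≤ λ_i/2 for each i ∈ S, and choose pairs (λ̂_i, v̂_i) ∈ ℝ × ℝ^n for i ∈ S with |λ_i − λ̂_i| ≤ ε̂, ‖v̂_i‖₂ = 1, and ⟨v_i, v̂_i⟩ ≥ 1 − 2(ε̂/λ_i)² > 0. Define Δ_i := λ_i v_i^⊗p − λ̂_i v̂_i^⊗p. Let x = Σ_{i=1}^n x_i v_i be a unit vector and let S₁ := {i ∈ S : λ_i|x_i| ≥ 4ε̂}. Then ‖Σ_{i∈S₁} Δ_i x^⊗(p−1)‖₂ ≤ 2^{p+1} p (Σ_{i∈S₁} x_i^{2(p−2)})^{1/2} ε̂ + 2^{p+1}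 Σ_{i∈S₁} |x_i|^{p−1} ε̂. -/
open scoped RealInnerProductSpace BigOperators

/-- Unit vectors with inner product at least `1 - 2 * t ^ 2` are at distance at most `2 * t`. -/
theorem norm_sub_le_two_mul_of_le_inner {E : Type*} [NormedAddCommGroup E] [InnerProductSpace ℝ E]
    {a b : E} {t : ℝ} (ha : ‖a‖ = 1) (hb : ‖b‖ = 1) (ht : 0 ≤ t) (h : 1 - 2 * t ^ 2 ≤ ⟪a, b⟫) :
    ‖a - b‖ ≤ 2 * t := by
  have h1 := norm_sub_sq_real a b
  rw [ha, hb] at h1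
  exact abs_le_of_sq_le_sq' (by nlinarith) (by positivity) |>.2

/-- The norm of a linear combination of an orthonormal family. -/
theorem Orthonormal.norm_sum_smul_eq_sqrt {ι E : Type*} [NormedAddCommGroup E]
    [InnerProductSpace ℝ E] {v : ι → E} (hv : Orthonormal ℝ v) (s : Finset ι) (c : ι → ℝ) :
    ‖∑ i ∈ s, c i • v i‖ = √(∑ i ∈ s, c i ^ 2) := by
  rw [norm_eq_sqrt_real_inner, hv.inner_sum]
  simp [sq]

/-- Perturbation of the coefficient `l * a ^ (m + 1)`. -/
theorem abs_mul_pow_sub_mul_pow_le {m : ℕ} {l k a b e : ℝ} (hl : 0 < l) (he : 0 ≤ e)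
    (hel : e ≤ l / 2) (hlk : |l - k| ≤ e) (hab : |a - b| ≤ 2 * (e / l))
    (hea : 4 * e ≤ l * |a|) (ha : |a| ≤ 1) :
    |l * a ^ (m + 1) - k * b ^ (m + 1)| ≤ 2 ^ (m + 3) * (m + 2) * e * |a| ^ m ∧
      |k * b ^ (m + 1)| * (2 * (e / l)) ≤ 2 ^ (m + 3) * |a| ^ (m + 1) * e := by
  have hk : |k| ≤ 3 / 2 * l := by
    have := abs_sub_abs_le_abs_sub k l
    rw [abs_sub_comm k l, abs_of_pos hl] at this
    linarith
  have hd : 2 * (e / l) ≤ |a| / 2 := by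
    rw [← mul_div_assoc, div_le_iff₀ hl]
    linarith
  have hle : l * (e / l) = e := by field_simp
  have hb : |b| ≤ 2 * |a| := by
    have := abs_sub_abs_le_abs_sub b a
    rw [abs_sub_comm b a] at this
    linarith [abs_nonneg a]
  have hmax : max |a| |b| ≤ 2 * |a| := max_le (by linarith [abs_nonneg a]) hb
  have hel0 : 0 ≤ e / l := by positivity
  have hpow : |a ^ (m + 1) - b ^ (m + 1)| ≤ 2 * (e / l) * (m + 1) * (2 * |a|) ^ m := by
    refine (abs_pow_sub_pow_le a b (m + 1)).trans ?_
    push_cast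
    gcongr
  constructor
  · calc |l * a ^ (m + 1) - k * b ^ (m + 1)|
        = |(l - k) * a ^ (m + 1) + k * (a ^ (m + 1) - b ^ (m + 1))| := by ring_nf
      _ ≤ |l - k| * (|a| ^ m * |a|) + |k| * |a ^ (m + 1) - b ^ (m + 1)| := by
        rw [← pow_succ, ← abs_pow, ← abs_mul, ← abs_mul]
        exact abs_add_le _ _
      _ ≤ e * (|a| ^ m * 1) + 3 / 2 * l * (2 * (e / l) * (m + 1) * (2 * |a|) ^ m) := by gcongr
      _ = e * |a| ^ m * 1 + 3 * (m + 1) * 2 ^ m * (l * (e / l)) * |a| ^ m := by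
        rw [mul_pow]; ring
      _ ≤ e * |a| ^ m * 2 ^ m + 3 * (m + 1) * 2 ^ m * (l * (e / l)) * |a| ^ m := by
        gcongr
        exact one_le_pow₀ one_le_two
      _ = (3 * m + 4) * (2 ^ m * e * |a| ^ m) := by rw [hle]; ring
      _ ≤ (8 * (m + 2)) * (2 ^ m * e * |a| ^ m) := by
        gcongr
        linarith [(Nat.cast_nonneg m : (0 : ℝ) ≤ m)]
      _ = 2 ^ (m + 3) * (m + 2) * e * |a| ^ m := by ring
  · calc |k * b ^ (m + 1)| * (2 * (e / l))
        = |k| * |b| ^ (m + 1) * (2 * (e / l)) := by rw [abs_mul, abs_pow]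
      _ ≤ 3 / 2 * l * (2 * |a|) ^ (m + 1) * (2 * (e / l)) := by gcongr
      _ = 6 * (2 ^ m * |a| ^ (m + 1) * (l * (e / l))) := by rw [mul_pow]; ring
      _ ≤ 8 * (2 ^ m * |a| ^ (m + 1) * (l * (e / l))) := by gcongr; norm_num
      _ = 2 ^ (m + 3) * |a| ^ (m + 1) * e := by rw [hle]; ring

/-- part of Lemma 3.2 of the paper. With `Δᵢ := λᵢ vᵢ^⊗p − λ̂ᵢ v̂ᵢ^⊗p`,
`x` a unit vector, `xᵢ := ⟨vᵢ, x⟩`, and `S₁ := {i ∈ S : λᵢ|xᵢ| ≥ 4ε̂}`, we have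
`‖∑_{i∈S₁} Δᵢ x^{⊗(p−1)}‖₂ ≤ 2^{p+1} p (∑_{i∈S₁} xᵢ^{2(p−2)})^{1/2} ε̂
  + 2^{p+1} (∑_{i∈S₁} |xᵢ|^{p−1}) ε̂`,
where `Δᵢ x^{⊗(p−1)} = λᵢ ⟨vᵢ,x⟩^{p−1} vᵢ − λ̂ᵢ ⟨v̂ᵢ,x⟩^{p−1} v̂ᵢ`. -/
theorem deflation_lemma_S1
    {n : ℕ} (p : ℕ) (hp : 3 ≤ p)
    (v : Fin n → EuclideanSpace ℝ (Fin n)) (hv : Orthonormal ℝ v)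
    (S : Finset (Fin n)) (lam lamh : Fin n → ℝ)
    (vh : Fin n → EuclideanSpace ℝ (Fin n))
    (εh : ℝ) (hεh0 : 0 ≤ εh)
    (hlam : ∀ i ∈ S, 0 < lam i)
    (hεh : ∀ i ∈ S, εh ≤ lam i / 2)
    (hclose : ∀ i ∈ S, |lam i - lamh i| ≤ εh)
    (hunit : ∀ i ∈ S, ‖vh i‖ = 1)
    (hcorr : ∀ i ∈ S, 1 - 2 * (εh / lam i)^2 ≤ ⟪v i, vh i⟫ ∧ 0 < 1 - 2 * (εh / lam i)^2)
    (x : EuclideanSpace ℝ (Fin n)) (hx : ‖x‖ = 1) :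
    ‖∑ i ∈ S.filter (fun i => 4 * εh ≤ lam i * |⟪v i, x⟫|),
        ((lam i * ⟪v i, x⟫ ^ (p - 1)) • v i - (lamh i * ⟪vh i, x⟫ ^ (p - 1)) • vh i)‖ ≤
      2 ^ (p + 1) * p *
          Real.sqrt (∑ i ∈ S.filter (fun i => 4 * εh ≤ lam i * |⟪v i, x⟫|),
            ⟪v i, x⟫ ^ (2 * (p - 2))) * εh +
        2 ^ (p + 1) *
          (∑ i ∈ S.filter (fun i => 4 * εh ≤ lam i * |⟪v i, x⟫|), |⟪v i, x⟫| ^ (p - 1)) * εh := by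
  obtain ⟨m, rfl⟩ : ∃ m, p = m + 2 := ⟨p - 2, by omega⟩
  simp only [show m + 2 - 1 = m + 1 by omega, show m + 2 - 2 = m by omega]
  set T := S.filter (fun i => 4 * εh ≤ lam i * |⟪v i, x⟫|)
  have hdist : ∀ i ∈ T, ‖v i - vh i‖ ≤ 2 * (εh / lam i) := fun i hi => by
    have hi := (Finset.mem_filter.1 hi).1
    exact norm_sub_le_two_mul_of_le_inner (hv.1 i) (hunit i hi)
      (div_nonneg hεh0 (hlam i hi).le) (hcorr i hi).1
  have hbound := fun i (hi : i ∈ T) => by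
    obtain ⟨hS, hge⟩ := Finset.mem_filter.1 hi
    refine abs_mul_pow_sub_mul_pow_le (m := m) (b := ⟪vh i, x⟫) (hlam i hS) hεh0 (hεh i hS)
      (hclose i hS) ?_ hge ?_
    · rw [← inner_sub_left]
      refine (abs_real_inner_le_norm _ _).trans ?_
      rw [hx, mul_one]
      exact hdist i hi
    · simpa [hv.1 i, hx] using abs_real_inner_le_norm (v i) x
  calc _ = ‖∑ i ∈ T, (lam i * ⟪v i, x⟫ ^ (m + 1) - lamh i * ⟪vh i, x⟫ ^ (m + 1)) • v i
        + ∑ i ∈ T, (lamh i * ⟪vh i, x⟫ ^ (m + 1)) • (v i - vh i)‖ := by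
        rw [← Finset.sum_add_distrib]
        congr 1
        refine Finset.sum_congr rfl fun i _ => ?_
        rw [sub_smul, smul_sub]
        abel
    _ ≤ _ := norm_add_le _ _
    _ ≤ _ := add_le_add ?_ ?_
  · rw [hv.norm_sum_smul_eq_sqrt]
    refine Real.sqrt_le_iff.2 ⟨by positivity, ?_⟩
    rw [mul_pow, mul_pow, Real.sq_sqrt (Finset.sum_nonneg fun i _ => by
      rw [pow_mul']; positivity), mul_right_comm, ← mul_pow, Finset.mul_sum]
    refine Finset.sum_le_sum fun i hi => ?_
    rw [pow_mul', ← sq_abs (⟪v i, x⟫ ^ m), abs_pow, ← mul_pow, ← sq_abs]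
    push_cast
    gcongr
    exact (hbound i hi).1
  · refine (norm_sum_le _ _).trans ?_
    rw [Finset.mul_sum, Finset.sum_mul]
    refine Finset.sum_le_sum fun i hi => ?_
    rw [norm_smul, Real.norm_eq_abs]
    exact (mul_le_mul_of_nonneg_left (hdist i hi) (abs_nonneg _)).trans (hbound i hi).2
end

section
/- Let p ≥ 3 be an integer, {v₁,…,v_n} an orthonormal basis of ℝ^n, and λ_i > 0 for i ∈ S ⊆ {1,…,n}. Assume 0 ≤ ε̂ ≤ λ_i/2 for each i ∈ S, and choose pairs (λ̂_i, v̂_i) ∈ ℝ × ℝ^n for i ∈ S with |λ_i − λ̂_i| ≤ ε̂, ‖v̂_i‖₂ = 1, and ⟨v_i, v̂_i⟩ ≥ 1 − 2(ε̂/λ_i)² > 0. Define Δ_i := λ_i v_i^⊗p − λ̂_i v̂_i^⊗p. Let x = Σ_{i=1}^n x_i v_i be a unit vector and let S₂ := {i ∈ S : λ_i|x_i| < 4ε̂}. Then ‖Σ_{i∈S₂} Δ_i x^⊗(p−1)‖₂ ≤ 6^p (Σ_{i∈S₂} (ε̂/λ_i)^{2(p−2)})^{1/2} ε̂ + 6^p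 Σ_{i∈S₂} (ε̂/λ_i)^{p−1} ε̂. -/
open scoped RealInnerProductSpace BigOperators

/-- The component of a unit vector `w` orthogonal to a unit vector `v` has norm at most `2 r`
when `⟪v, w⟫ ≥ 1 - 2 r ^ 2 ≥ 0`. -/
theorem norm_sub_inner_smul_le {E : Type*} [NormedAddCommGroup E] [InnerProductSpace ℝ E]
    {v w : E} (hv : ‖v‖ = 1) (hw : ‖w‖ = 1) {r : ℝ} (hr : 0 ≤ r) (hr' : 0 ≤ 1 - 2 * r ^ 2)
    (hvw : 1 - 2 * r ^ 2 ≤ ⟪v, w⟫) : ‖w - ⟪v, w⟫ • v‖ ≤ 2 * r := by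
  have hsq : ‖w - ⟪v, w⟫ • v‖ ^ 2 = 1 - ⟪v, w⟫ ^ 2 := by
    rw [norm_sub_sq_real, norm_smul, inner_smul_right, real_inner_comm v w, hv, hw,
      Real.norm_eq_abs, mul_one, sq_abs]
    ring
  refine abs_le_of_sq_le_sq' ?_ (by positivity) |>.2
  rw [hsq]
  nlinarith [sq_nonneg (r ^ 2)]

/-- The norm of an orthonormal combination is at most the `ℓ²` norm of a bound on its
coefficients. -/
theorem Orthonormal.norm_sum_smul_le {ι E : Type*} [NormedAddCommGroup E]
    [InnerProductSpace ℝ E] {v : ι → E} (hv : Orthonormal ℝ v) (T : Finset ι) {a b : ι → ℝ}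
    (hab : ∀ i ∈ T, |a i| ≤ b i) :
    ‖∑ i ∈ T, a i • v i‖ ≤ Real.sqrt (∑ i ∈ T, b i ^ 2) := by
  refine Real.le_sqrt_of_sq_le ?_
  rw [← real_inner_self_eq_norm_sq, hv.inner_sum]
  refine Finset.sum_le_sum fun i hi => ?_
  have h := sq_le_sq' (neg_le_of_abs_le (hab i hi)) (le_of_abs_le (hab i hi))
  simpa [sq] using h

/-- Bounds for the components of `l • ⟪v, x⟫ ^ (k + 1) • v - m • ⟪w, x⟫ ^ (k + 1) • w` along `v`
and orthogonal to `v`, when `(m, w)` approximates `(l, v)` and `l * |⟪v, x⟫| < 4 * e`. -/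
theorem deflation_component_bounds {E : Type*} [NormedAddCommGroup E] [InnerProductSpace ℝ E]
    {v w x : E} (hv : ‖v‖ = 1) (hw : ‖w‖ = 1) (hx : ‖x‖ = 1) {l m e : ℝ} (he : 0 ≤ e)
    (hl : 0 < l) (hel : e ≤ l / 2) (hlm : |l - m| ≤ e)
    (hvw : 1 - 2 * (e / l) ^ 2 ≤ ⟪v, w⟫) (hpos : 0 < 1 - 2 * (e / l) ^ 2)
    (hxl : l * |⟪v, x⟫| < 4 * e) (k : ℕ) :
    |l * ⟪v, x⟫ ^ (k + 1) - m * ⟪w, x⟫ ^ (k + 1) * ⟪v, w⟫| ≤ 6 ^ (k + 2) * e * (e / l) ^ k ∧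
      ‖(m * ⟪w, x⟫ ^ (k + 1)) • (w - ⟪v, w⟫ • v)‖ ≤ 6 ^ (k + 2) * (e / l) ^ (k + 1) * e := by
  have hr : 0 ≤ e / l := by positivity
  have hlr : l * (e / l) = e := by field_simp
  have hort := norm_sub_inner_smul_le hv hw hr hpos.le hvw
  set r := e / l
  have hc : |⟪v, w⟫| ≤ 1 := by simpa [hv, hw] using abs_real_inner_le_norm v w
  have hvx : |⟪v, x⟫| ≤ 4 * r := by
    refine le_of_mul_le_mul_left ?_ hl
    linarith
  have hwx : |⟪w, x⟫| ≤ 6 * r := by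
    have hdec : ⟪w, x⟫ = ⟪v, w⟫ * ⟪v, x⟫ + ⟪w - ⟪v, w⟫ • v, x⟫ := by
      rw [inner_sub_left, real_inner_smul_left]
      ring
    have h1 : |⟪w - ⟪v, w⟫ • v, x⟫| ≤ 2 * r := by
      refine (abs_real_inner_le_norm _ _).trans ?_
      rwa [hx, mul_one]
    have h2 : |⟪v, w⟫ * ⟪v, x⟫| ≤ 4 * r := by
      rw [abs_mul]
      exact (mul_le_of_le_one_left (abs_nonneg _) hc).trans hvx
    rw [hdec]
    exact (abs_add_le _ _).trans (by linarith)
  have hm : |m| ≤ 3 / 2 * l := by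
    rw [abs_le] at hlm ⊢
    constructor <;> linarith
  have hvp : |⟪v, x⟫ ^ (k + 1)| ≤ 6 ^ (k + 1) * r ^ (k + 1) := by
    rw [abs_pow, ← mul_pow]
    exact pow_le_pow_left₀ (abs_nonneg _) (by linarith) _
  have hwp : |⟪w, x⟫ ^ (k + 1)| ≤ 6 ^ (k + 1) * r ^ (k + 1) := by
    rw [abs_pow, ← mul_pow]
    exact pow_le_pow_left₀ (abs_nonneg _) hwx _
  have hmw : |m * ⟪w, x⟫ ^ (k + 1)| ≤ 3 / 2 * l * (6 ^ (k + 1) * r ^ (k + 1)) := by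
    rw [abs_mul]
    gcongr
  have hlP : l * (6 ^ (k + 1) * r ^ (k + 1)) = 6 ^ (k + 1) * e * r ^ k := by
    rw [← hlr]
    ring
  constructor
  · have h1 : |l * ⟪v, x⟫ ^ (k + 1)| ≤ l * (6 ^ (k + 1) * r ^ (k + 1)) := by
      rw [abs_mul, abs_of_pos hl]
      gcongr
    have h2 : |m * ⟪w, x⟫ ^ (k + 1) * ⟪v, w⟫| ≤ 3 / 2 * l * (6 ^ (k + 1) * r ^ (k + 1)) := by
      rw [abs_mul]
      exact (mul_le_of_le_one_right (abs_nonneg _) hc).trans hmw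
    have h3 : 0 ≤ 6 ^ (k + 1) * e * r ^ k := by positivity
    have h4 : 6 ^ (k + 2) * e * r ^ k = 6 * (6 ^ (k + 1) * e * r ^ k) := by ring
    refine (abs_sub _ _).trans ?_
    rw [h4]
    linarith
  · rw [norm_smul, Real.norm_eq_abs]
    have h1 : 0 ≤ 6 ^ (k + 1) * r ^ (k + 1) * e := by positivity
    calc _ ≤ 3 / 2 * l * (6 ^ (k + 1) * r ^ (k + 1)) * (2 * r) := by gcongr
      _ = 3 * (6 ^ (k + 1) * r ^ (k + 1) * (l * r)) := by ring
      _ ≤ 6 * (6 ^ (k + 1) * r ^ (k + 1) * e) := by rw [hlr]; linarith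
      _ = _ := by ring

/-- part of Lemma 3.2 of the paper. With `Δᵢ := λᵢ vᵢ^⊗p − λ̂ᵢ v̂ᵢ^⊗p`,
`x` a unit vector, `xᵢ := ⟨vᵢ, x⟩`, and `S₂ := {i ∈ S : λᵢ|xᵢ| < 4ε̂}`, we have
`‖∑_{i∈S₂} Δᵢ x^{⊗(p−1)}‖₂ ≤ 6^p (∑_{i∈S₂} (ε̂/λᵢ)^{2(p−2)})^{1/2} ε̂
  + 6^p ∑_{i∈S₂} (ε̂/λᵢ)^{p−1} ε̂`,
where `Δᵢ x^{⊗(p−1)} = λᵢ ⟨vᵢ,x⟩^{p−1} vᵢ − λ̂ᵢ ⟨v̂ᵢ,x⟩^{p−1} v̂ᵢ`. -/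
theorem deflation_lemma_S2
    {n : ℕ} (p : ℕ) (hp : 3 ≤ p)
    (v : Fin n → EuclideanSpace ℝ (Fin n)) (hv : Orthonormal ℝ v)
    (S : Finset (Fin n)) (lam lamh : Fin n → ℝ)
    (vh : Fin n → EuclideanSpace ℝ (Fin n))
    (εh : ℝ) (hεh0 : 0 ≤ εh)
    (hlam : ∀ i ∈ S, 0 < lam i)
    (hεh : ∀ i ∈ S, εh ≤ lam i / 2)
    (hclose : ∀ i ∈ S, |lam i - lamh i| ≤ εh)
    (hunit : ∀ i ∈ S, ‖vh i‖ = 1)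
    (hcorr : ∀ i ∈ S, 1 - 2 * (εh / lam i)^2 ≤ ⟪v i, vh i⟫ ∧ 0 < 1 - 2 * (εh / lam i)^2)
    (x : EuclideanSpace ℝ (Fin n)) (hx : ‖x‖ = 1) :
    ‖∑ i ∈ S.filter (fun i => lam i * |⟪v i, x⟫| < 4 * εh),
        ((lam i * ⟪v i, x⟫ ^ (p - 1)) • v i - (lamh i * ⟪vh i, x⟫ ^ (p - 1)) • vh i)‖ ≤
      6 ^ p *
          Real.sqrt (∑ i ∈ S.filter (fun i => lam i * |⟪v i, x⟫| < 4 * εh),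
            (εh / lam i) ^ (2 * (p - 2))) * εh +
        6 ^ p *
          (∑ i ∈ S.filter (fun i => lam i * |⟪v i, x⟫| < 4 * εh), (εh / lam i) ^ (p - 1)) * εh := by
  obtain ⟨k, rfl⟩ : ∃ k, p = k + 2 := ⟨p - 2, by omega⟩
  simp only [Nat.add_sub_cancel, show k + 2 - 1 = k + 1 from rfl]
  set T := S.filter (fun i => lam i * |⟪v i, x⟫| < 4 * εh)
  have key : ∀ i ∈ T, _ ∧ _ := fun i hi =>
    have hS := (Finset.mem_filter.1 hi).1
    deflation_component_bounds (hv.norm_eq_one i) (hunit i hS) hx hεh0 (hlam i hS) (hεh i hS)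
      (hclose i hS) (hcorr i hS).1 (hcorr i hS).2 (Finset.mem_filter.1 hi).2 k
  have hsplit : ∀ i ∈ T,
      (lam i * ⟪v i, x⟫ ^ (k + 1)) • v i - (lamh i * ⟪vh i, x⟫ ^ (k + 1)) • vh i =
        (lam i * ⟪v i, x⟫ ^ (k + 1) - lamh i * ⟪vh i, x⟫ ^ (k + 1) * ⟪v i, vh i⟫) • v i -
          (lamh i * ⟪vh i, x⟫ ^ (k + 1)) • (vh i - ⟪v i, vh i⟫ • v i) := fun i _ => by
    module
  rw [Finset.sum_congr rfl hsplit, Finset.sum_sub_distrib]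
  refine (norm_sub_le _ _).trans (add_le_add ?_ ?_)
  · refine (hv.norm_sum_smul_le T fun i hi => (key i hi).1).trans_eq ?_
    have hsum : ∑ i ∈ T, (6 ^ (k + 2) * εh * (εh / lam i) ^ k) ^ 2 =
        (6 ^ (k + 2) * εh) ^ 2 * ∑ i ∈ T, (εh / lam i) ^ (2 * k) := by
      rw [Finset.mul_sum]
      exact Finset.sum_congr rfl fun i _ => by ring
    rw [hsum, Real.sqrt_mul (sq_nonneg _), Real.sqrt_sq (by positivity)]
    ring
  · rw [Finset.mul_sum, Finset.sum_mul]
    exact norm_sum_le_of_le _ fun i hi => (key i hi).2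
end
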